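/- arXiv:2104.12065 — 2 statements merged into one kernel-verified Lean document; each statement's English description precedes it below -/
import Mathlib

section
/- Laplace transform of the first marginal of the stationary distribution. Assume a₁ > 0, b₂ > 0, and ∫_{{z₁>1}} z₁ n(dz) < ∞, and let π be the unique stationary (invariant) distribution of (P_t)_{t≥0}. Define, for real z ≤ 0, P(z) = a₂ z + ∫_G (e^{z z₁} − 1) n(dz') (where z₁ is the first coordinate of z') and φ̃₀(z) = −a₁ z + (α₁₁+α₁₂) z² + ∫_G (e^{z z₁} − 1 − z z₁) m(dz'). Then for every real u₁ ≤ 0, ∫_G e^{u₁ y₁} π(dy) = exp{ ∫_{u₁}^0 P(z)/φ̃₀(z) dz }. -/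
open MeasureTheory Filter Set Topology
open scoped ENNReal Classical

noncomputable section

namespace AffinePaper

/-- Total variation distance between two measures:
`‖μ - ν‖_var = sup {|∫ f dμ - ∫ f dν| : f measurable, |f| ≤ 1}`. -/
def tvDist {α : Type*} [MeasurableSpace α] (μ ν : Measure α) : ℝ :=
  ⨆ f : {f : α → ℝ // Measurable f ∧ ∀ x, |f x| ≤ 1},
    |(∫ x, f.1 x ∂μ) - ∫ x, f.1 x ∂ν|

/-- Translate of a measure on `ℝ` by `a`, i.e. `δ_a * σ`. -/
def translate (a : ℝ) (σ : Measure ℝ) : Measure ℝ := Measure.map (fun x => x + a) σ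

/-- The function `φ` of the affine process. -/
def phi (a₁ b₁ α₁₁ α₁₂ α₂₁ α₂₂ : ℝ) (m : Measure (ℝ × ℝ)) (u : ℂ × ℂ) : ℂ :=
  -(a₁ : ℂ) * u.1 - (b₁ : ℂ) * u.2 + ((α₁₁ : ℂ) + (α₁₂ : ℂ)) * u.1 ^ 2
    + 2 * ((Real.sqrt (α₁₁ * α₂₁) : ℂ) + (Real.sqrt (α₁₂ * α₂₂) : ℂ)) * u.1 * u.2
    + ((α₂₁ : ℂ) + (α₂₂ : ℂ)) * u.2 ^ 2
    + ∫ z : ℝ × ℝ,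
        (Complex.exp (u.1 * (z.1 : ℂ) + u.2 * (z.2 : ℂ)) - 1
          - (u.1 * (z.1 : ℂ) + u.2 * (z.2 : ℂ))) ∂m

/-- The function `ψ` of the affine process. -/
def psi (a₂ b₀ σ : ℝ) (n : Measure (ℝ × ℝ)) (u : ℂ × ℂ) : ℂ :=
  (a₂ : ℂ) * u.1 - (b₀ : ℂ) * u.2 + (σ : ℂ) ^ 2 / 2 * u.2 ^ 2
    + ∫ z : ℝ × ℝ,
        (Complex.exp (u.1 * (z.1 : ℂ) + u.2 * (z.2 : ℂ)) - 1 - (z.2 : ℂ) * u.2) ∂n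

/-- The branching mechanism `φ₀`. -/
def phi0 (a₁ α₁₁ α₁₂ : ℝ) (m : Measure (ℝ × ℝ)) (x : ℝ) : ℝ :=
  a₁ * x + (α₁₁ + α₁₂) * x ^ 2 + ∫ z : ℝ × ℝ, (Real.exp (-x * z.1) - 1 + x * z.1) ∂m

/-- Condition (A): Grey's condition. -/
def CondA (a₁ α₁₁ α₁₂ : ℝ) (m : Measure (ℝ × ℝ)) : Prop :=
  ∃ θ > (0 : ℝ), (∀ z ≥ θ, 0 < phi0 a₁ α₁₁ α₁₂ m z) ∧
    ∫⁻ z in Set.Ici θ, ENNReal.ofReal (phi0 a₁ α₁₁ α₁₂ m z)⁻¹ < ⊤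

/-- The measure `n_ε` on `ℝ`. -/
def nEps (n : Measure (ℝ × ℝ)) (ε : ℝ) : Measure ℝ :=
  if n {z : ℝ × ℝ | 0 ≤ z.1} < ⊤ then
    Measure.map Prod.snd (n.restrict {z : ℝ × ℝ | 0 ≤ z.1})
  else
    Measure.map Prod.snd (n.restrict {z : ℝ × ℝ | 0 ≤ z.1 ∧ ε ≤ |z.2|})

/-- Condition (B), with the constants `ε, η` explicit. -/
def CondB (n : Measure (ℝ × ℝ)) (ε η : ℝ) : Prop :=
  0 < ε ∧ 0 < η ∧
  (∃ c : ℝ≥0∞, 0 < c ∧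
      ∀ a : ℝ, |a| ≤ η → c ≤ (nEps n ε ⊓ translate a (nEps n ε)) Set.univ) ∧
  ∫⁻ z in {z : ℝ × ℝ | ε < |z.2|}, ENNReal.ofReal |z.2| ∂n < ⊤

/-- `limsup_{ρ → 0} [ sup_{|a| ≤ ρ} ‖σ - δ_a * σ‖_var / ρ ] < ∞`. -/
def SmoothShift (σ : Measure ℝ) : Prop :=
  ∃ C > (0 : ℝ), ∃ δ > (0 : ℝ), ∀ ρ : ℝ, 0 < ρ → ρ ≤ δ →
    ∀ a : ℝ, |a| ≤ ρ → tvDist σ (translate a σ) ≤ C * ρ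

/-- Condition (C), with the constant `ε` explicit. -/
def CondC (n : Measure (ℝ × ℝ)) (ε : ℝ) : Prop :=
  0 < ε ∧ 0 < nEps n ε Set.univ ∧ SmoothShift (nEps n ε) ∧
  ∫⁻ z in {z : ℝ × ℝ | ε < |z.2|}, ENNReal.ofReal |z.2| ∂n < ⊤

/-- Condition (C'), with the constant `ε` explicit. -/
def CondC' (n : Measure (ℝ × ℝ)) (ε : ℝ) : Prop :=
  0 < ε ∧ 0 < nEps n ε Set.univ ∧ SmoothShift (nEps n ε) ∧
  ∫⁻ z in {z : ℝ × ℝ | 1 < |z.2|}, ENNReal.ofReal (z.2 ^ 2) ∂n < ⊤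

/-- The measure `σ₀ = ϱ₀(z₂) dz₂` of Condition (D). -/
def sigma0 (ϱ₀ : ℝ → ℝ) : Measure ℝ :=
  volume.withDensity fun x => ENNReal.ofReal (ϱ₀ x)

/-- The measure `σ_k = ((k g) ∧ ϱ₀)(z₂) dz₂` of Condition (D). -/
def sigmaK (ϱ₀ g : ℝ → ℝ) (k : ℕ) : Measure ℝ :=
  volume.withDensity fun x => ENNReal.ofReal (min ((k : ℝ) * g x) (ϱ₀ x))

/-- Condition (D), with `ϱ₀`, `g` and `K` explicit. -/
def CondD (n : Measure (ℝ × ℝ)) (ϱ₀ g : ℝ → ℝ) (K : ℕ) : Prop :=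
  Measurable ϱ₀ ∧ (∀ x, 0 ≤ ϱ₀ x) ∧
  (∀ B : Set ℝ, MeasurableSet B → sigma0 ϱ₀ B ≤ n {z : ℝ × ℝ | 0 ≤ z.1 ∧ z.2 ∈ B}) ∧
  0 < sigma0 ϱ₀ Set.univ ∧
  (∀ x, 0 < g x) ∧ Integrable g ∧ 1 ≤ K ∧
  ∀ k, K ≤ k → SmoothShift (sigmaK ϱ₀ g k) ∧
    ∫⁻ x, ENNReal.ofReal |x| ∂(sigmaK ϱ₀ g k) < ⊤

/-- The transition semigroup of a (1+1)-dimensional affine Markov process, together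
with all the standing assumptions of the paper. -/
structure AffineSemigroup where
  a₁ : ℝ
  a₂ : ℝ
  b₀ : ℝ
  b₁ : ℝ
  b₂ : ℝ
  σ : ℝ
  α₁₁ : ℝ
  α₁₂ : ℝ
  α₂₁ : ℝ
  α₂₂ : ℝ
  m : Measure (ℝ × ℝ)
  n : Measure (ℝ × ℝ)
  V₁ : ℝ → ℂ × ℂ → ℂ
  P : ℝ → ℝ × ℝ → Measure (ℝ × ℝ)
  a₂_nonneg : 0 ≤ a₂
  σ_nonneg : 0 ≤ σ
  α₁₁_nonneg : 0 ≤ α₁₁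
  α₁₂_nonneg : 0 ≤ α₁₂
  α₂₁_nonneg : 0 ≤ α₂₁
  α₂₂_nonneg : 0 ≤ α₂₂
  m_supp : m {z : ℝ × ℝ | z.1 < 0 ∨ z = 0} = 0
  n_supp : n {z : ℝ × ℝ | z.1 < 0 ∨ z = 0} = 0
  m_int : ∫⁻ z : ℝ × ℝ, ENNReal.ofReal (min z.1 (z.1 ^ 2) + z.2 ^ 2) ∂m < ⊤
  n_int : ∫⁻ z : ℝ × ℝ, ENNReal.ofReal (min 1 z.1 + min |z.2| (z.2 ^ 2)) ∂n < ⊤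
  V₁_init : ∀ u : ℂ × ℂ, V₁ 0 u = u.1
  V₁_mem : ∀ u : ℂ × ℂ, u.1.re ≤ 0 → u.2.re = 0 → ∀ t, 0 ≤ t → (V₁ t u).re ≤ 0
  V₁_ode : ∀ u : ℂ × ℂ, u.1.re ≤ 0 → u.2.re = 0 → ∀ t, 0 ≤ t →
    HasDerivAt (fun s => V₁ s u)
      (phi a₁ b₁ α₁₁ α₁₂ α₂₁ α₂₂ m
        (V₁ t u, Complex.exp (-(b₂ : ℂ) * (t : ℂ)) * u.2)) t
  P_prob : ∀ t, 0 ≤ t → ∀ x : ℝ × ℝ, 0 ≤ x.1 → IsProbabilityMeasure (P t x)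
  P_supp : ∀ t, 0 ≤ t → ∀ x : ℝ × ℝ, 0 ≤ x.1 → P t x {ξ : ℝ × ℝ | ξ.1 < 0} = 0
  P_meas : ∀ t, 0 ≤ t → Measurable (P t)
  P_zero : ∀ x : ℝ × ℝ, P 0 x = Measure.dirac x
  P_CK : ∀ t, 0 ≤ t → ∀ s, 0 ≤ s → ∀ x : ℝ × ℝ, P (t + s) x = (P t x).bind (P s)
  P_char : ∀ t, 0 ≤ t → ∀ x : ℝ × ℝ, 0 ≤ x.1 → ∀ u : ℂ × ℂ, u.1.re = 0 → u.2.re = 0 →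
    ∫ ξ : ℝ × ℝ, Complex.exp (u.1 * (ξ.1 : ℂ) + u.2 * (ξ.2 : ℂ)) ∂(P t x)
      = Complex.exp ((x.1 : ℂ) * V₁ t u
          + (x.2 : ℂ) * (Complex.exp (-(b₂ : ℂ) * (t : ℂ)) * u.2)
          + ∫ s in (0:ℝ)..t,
              psi a₂ b₀ σ n (V₁ s u, Complex.exp (-(b₂ : ℂ) * (s : ℂ)) * u.2))

/-- A stationary (invariant) distribution for the semigroup `P` on `G = ℝ₊ × ℝ`. -/
def IsStationary (P : ℝ → ℝ × ℝ → Measure (ℝ × ℝ)) (π : Measure (ℝ × ℝ)) : Prop :=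
  IsProbabilityMeasure π ∧ π {x : ℝ × ℝ | x.1 < 0} = 0 ∧ ∀ t, 0 ≤ t → π.bind (P t) = π

/-- Defining properties of the minimal solution `v̄` of `(d/dt) v̄_t = -φ₀(v̄_t)`,
`v̄_{0+} = ∞`. -/
def IsVbar (a₁ α₁₁ α₁₂ : ℝ) (m : Measure (ℝ × ℝ)) (v : ℝ → ℝ) : Prop :=
  (∀ t > (0 : ℝ), 0 < v t) ∧
  (∀ t > (0 : ℝ), HasDerivAt v (-(phi0 a₁ α₁₁ α₁₂ m (v t))) t) ∧
  Tendsto v (𝓝[>] (0 : ℝ)) atTop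

/-- The function `P(z)` appearing in the Laplace transform of the stationary
distribution. -/
def Pfun (a₂ : ℝ) (n : Measure (ℝ × ℝ)) (z : ℝ) : ℝ :=
  a₂ * z + ∫ w : ℝ × ℝ, (Real.exp (z * w.1) - 1) ∂n

/-- The function `φ̃₀(z)`. -/
def tphi0 (a₁ α₁₁ α₁₂ : ℝ) (m : Measure (ℝ × ℝ)) (z : ℝ) : ℝ :=
  -a₁ * z + (α₁₁ + α₁₂) * z ^ 2 + ∫ w : ℝ × ℝ, (Real.exp (z * w.1) - 1 - z * w.1) ∂m

/-! ### Elementary estimates for the complex exponential on the left half-plane -/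

lemma norm_exp_sub_one_le_norm {w : ℂ} (hw : w.re ≤ 0) : ‖Complex.exp w - 1‖ ≤ ‖w‖ := by
  have hconv : Convex ℝ {w : ℂ | w.re ≤ 0} := convex_halfSpace_re_le 0
  have h := hconv.norm_image_sub_le_of_norm_hasDerivWithin_le (f := Complex.exp)
    (f' := Complex.exp) (C := 1) (x := 0) (y := w)
    (fun z _ => (Complex.hasDerivAt_exp z).hasDerivWithinAt)
    (fun z hz => by
      rw [Complex.norm_exp]
      exact Real.exp_le_one_iff.2 hz) (by simp) hw
  simpa using h

lemma norm_exp_sub_one_sub_self_le {w : ℂ} (hw : w.re ≤ 0) :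
    ‖Complex.exp w - 1 - w‖ ≤ ‖w‖ ^ 2 := by
  have hconv : Convex ℝ ({w : ℂ | w.re ≤ 0} ∩ Metric.closedBall 0 ‖w‖) :=
    (convex_halfSpace_re_le 0).inter (convex_closedBall 0 ‖w‖)
  have h := hconv.norm_image_sub_le_of_norm_hasDerivWithin_le
    (f := fun z => Complex.exp z - 1 - z)
    (f' := fun z => Complex.exp z - 1) (C := ‖w‖) (x := 0) (y := w)
    (fun z _ => (((Complex.hasDerivAt_exp z).sub_const 1).sub (hasDerivAt_id z)).hasDerivWithinAt)
    (fun z hz => by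
      have := norm_exp_sub_one_le_norm hz.1
      have h2 : ‖z‖ ≤ ‖w‖ := by simpa using hz.2
      exact this.trans h2) ⟨by simp, by simp⟩ ⟨hw, by simp⟩
  simpa [sq] using h

lemma norm_exp_sub_one_sub_self_le_two_mul {w : ℂ} (hw : w.re ≤ 0) :
    ‖Complex.exp w - 1 - w‖ ≤ 2 * ‖w‖ := by
  have := norm_sub_le (Complex.exp w - 1) w
  have := norm_exp_sub_one_le_norm hw
  linarith

lemma re_exp_sub_one_sub_self_mul_conj_nonpos {w : ℂ} (hw : w.re ≤ 0) :
    ((Complex.exp w - 1 - w) * (starRingEnd ℂ) w).re ≤ 0 := by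
  have h1 : ((Complex.exp w - 1) * (starRingEnd ℂ) w).re ≤ ‖w‖ ^ 2 := by
    refine (Complex.re_le_norm _).trans ?_
    rw [norm_mul, Complex.norm_conj, sq]
    gcongr
    exact norm_exp_sub_one_le_norm hw
  have h2 : (w * (starRingEnd ℂ) w).re = ‖w‖ ^ 2 := by
    rw [Complex.mul_conj, Complex.normSq_eq_norm_sq, Complex.ofReal_re]
  rw [sub_mul, Complex.sub_re, h2]
  linarith

lemma mul_ofReal_re_nonpos {u : ℂ} (hu : u.re ≤ 0) {x : ℝ} (hx : 0 ≤ x) :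
    (u * (x : ℂ)).re ≤ 0 := by
  rw [Complex.re_mul_ofReal]
  exact mul_nonpos_of_nonpos_of_nonneg hu hx

lemma norm_exp_mul_sub_one_le {u : ℂ} (hu : u.re ≤ 0) {x : ℝ} (hx : 0 ≤ x) :
    ‖Complex.exp (u * x) - 1‖ ≤ ‖u‖ * x := by
  refine (norm_exp_sub_one_le_norm (mul_ofReal_re_nonpos hu hx)).trans_eq ?_
  rw [norm_mul, Complex.norm_real, Real.norm_of_nonneg hx]

lemma norm_exp_mul_sub_one_sub_le {u : ℂ} (hu : u.re ≤ 0) {x : ℝ} (hx : 0 ≤ x) :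
    ‖Complex.exp (u * x) - 1 - u * x‖ ≤ (2 * ‖u‖ + ‖u‖ ^ 2) * min x (x ^ 2) := by
  have hw := mul_ofReal_re_nonpos hu hx
  have hn : ‖u * (x : ℂ)‖ = ‖u‖ * x := by
    rw [norm_mul, Complex.norm_real, Real.norm_of_nonneg hx]
  have h1 := norm_exp_sub_one_sub_self_le hw
  have h2 := norm_exp_sub_one_sub_self_le_two_mul hw
  rw [hn] at h1 h2
  rcases min_cases x (x ^ 2) with ⟨h, _⟩ | ⟨h, _⟩ <;> rw [h]
  · nlinarith [mul_nonneg (sq_nonneg ‖u‖) hx]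
  · nlinarith [mul_nonneg (norm_nonneg u) (sq_nonneg x)]

lemma norm_mul_exp_mul_sub_one_le {u : ℂ} (hu : u.re ≤ 0) {x : ℝ} (hx : 0 ≤ x) :
    ‖(x : ℂ) * (Complex.exp (u * x) - 1)‖ ≤ (2 + ‖u‖) * min x (x ^ 2) := by
  have h1 := norm_exp_mul_sub_one_le hu hx
  have h2 : ‖Complex.exp (u * x) - 1‖ ≤ 2 := by
    refine (norm_sub_le _ _).trans ?_
    have : ‖Complex.exp (u * x)‖ ≤ 1 := by
      rw [Complex.norm_exp]
      exact Real.exp_le_one_iff.2 (mul_ofReal_re_nonpos hu hx)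
    rw [norm_one]
    linarith
  rw [norm_mul, Complex.norm_real, Real.norm_of_nonneg hx]
  have hu0 := norm_nonneg u
  rcases min_cases x (x ^ 2) with ⟨h, _⟩ | ⟨h, _⟩ <;> rw [h]
  · nlinarith [mul_nonneg hu0 hx, mul_le_mul_of_nonneg_left h2 hx]
  · nlinarith [mul_le_mul_of_nonneg_left h1 hx, sq_nonneg x]

/-! ### The complex branching and immigration mechanisms -/

/-- The branching mechanism `u ↦ φ(u, 0)`. -/
def branching (a α : ℝ) (m : Measure (ℝ × ℝ)) (u : ℂ) : ℂ :=
  -(a : ℂ) * u + (α : ℂ) * u ^ 2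
    + ∫ z : ℝ × ℝ, (Complex.exp (u * (z.1 : ℂ)) - 1 - u * (z.1 : ℂ)) ∂m

/-- The immigration mechanism `u ↦ ψ(u, 0)`. -/
def immigration (a : ℝ) (n : Measure (ℝ × ℝ)) (u : ℂ) : ℂ :=
  (a : ℂ) * u + ∫ z : ℝ × ℝ, (Complex.exp (u * (z.1 : ℂ)) - 1) ∂n

section Mechanisms

variable {a α : ℝ} {m n : Measure (ℝ × ℝ)}

lemma eventually_re_neg_norm_lt {u : ℂ} (hu : u.re < 0) :
    {w : ℂ | w.re < 0 ∧ ‖w‖ < ‖u‖ + 1} ∈ 𝓝 u :=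
  ((isOpen_lt Complex.continuous_re continuous_const).inter
    (isOpen_lt continuous_norm continuous_const)).mem_nhds ⟨hu, by simp⟩

lemma integrable_exp_mul_sub_one_sub (hm0 : ∀ᵐ z ∂m, 0 ≤ z.1)
    (hm : Integrable (fun z : ℝ × ℝ => min z.1 (z.1 ^ 2)) m) {u : ℂ} (hu : u.re ≤ 0) :
    Integrable (fun z : ℝ × ℝ => Complex.exp (u * (z.1 : ℂ)) - 1 - u * (z.1 : ℂ)) m := by
  refine (hm.const_mul (2 * ‖u‖ + ‖u‖ ^ 2)).mono' (by fun_prop) ?_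
  filter_upwards [hm0] with z hz using norm_exp_mul_sub_one_sub_le hu hz

lemma integrable_exp_mul_sub_one (hn0 : ∀ᵐ z ∂n, 0 ≤ z.1)
    (hn : Integrable (fun z : ℝ × ℝ => z.1) n) {u : ℂ} (hu : u.re ≤ 0) :
    Integrable (fun z : ℝ × ℝ => Complex.exp (u * (z.1 : ℂ)) - 1) n := by
  refine (hn.const_mul ‖u‖).mono' (by fun_prop) ?_
  filter_upwards [hn0] with z hz using norm_exp_mul_sub_one_le hu hz

lemma continuousOn_branching (hm0 : ∀ᵐ z ∂m, 0 ≤ z.1)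
    (hm : Integrable (fun z : ℝ × ℝ => min z.1 (z.1 ^ 2)) m) :
    ContinuousOn (branching a α m) {u | u.re ≤ 0} := by
  intro u _
  refine ContinuousWithinAt.add (by fun_prop) ?_
  refine continuousWithinAt_of_dominated
    (bound := fun z => (2 * (‖u‖ + 1) + (‖u‖ + 1) ^ 2) * min z.1 (z.1 ^ 2))
    (Eventually.of_forall fun w => by fun_prop) ?_ (hm.const_mul _)
    (Eventually.of_forall fun z => by fun_prop)
  have h1 : ∀ᶠ w in 𝓝[{u | u.re ≤ 0}] u, ‖w‖ < ‖u‖ + 1 :=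
    nhdsWithin_le_nhds ((isOpen_lt continuous_norm continuous_const).mem_nhds (by simp))
  filter_upwards [h1, self_mem_nhdsWithin] with w hw hw0
  filter_upwards [hm0] with z hz
  refine (norm_exp_mul_sub_one_sub_le hw0 hz).trans ?_
  have : 0 ≤ min z.1 (z.1 ^ 2) := le_min hz (sq_nonneg _)
  gcongr

lemma continuousOn_immigration (hn0 : ∀ᵐ z ∂n, 0 ≤ z.1)
    (hn : Integrable (fun z : ℝ × ℝ => z.1) n) :
    ContinuousOn (immigration a n) {u | u.re ≤ 0} := by
  intro u _
  refine ContinuousWithinAt.add (by fun_prop) ?_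
  refine continuousWithinAt_of_dominated
    (bound := fun z => (‖u‖ + 1) * z.1)
    (Eventually.of_forall fun w => by fun_prop) ?_ (hn.const_mul _)
    (Eventually.of_forall fun z => by fun_prop)
  have h1 : ∀ᶠ w in 𝓝[{u | u.re ≤ 0}] u, ‖w‖ < ‖u‖ + 1 :=
    nhdsWithin_le_nhds ((isOpen_lt continuous_norm continuous_const).mem_nhds (by simp))
  filter_upwards [h1, self_mem_nhdsWithin] with w hw hw0
  filter_upwards [hn0] with z hz
  refine (norm_exp_mul_sub_one_le hw0 hz).trans ?_
  gcongr

lemma differentiableAt_branching (hm0 : ∀ᵐ z ∂m, 0 ≤ z.1)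
    (hm : Integrable (fun z : ℝ × ℝ => min z.1 (z.1 ^ 2)) m) {u : ℂ} (hu : u.re < 0) :
    DifferentiableAt ℂ (branching a α m) u := by
  refine DifferentiableAt.add (by fun_prop) ?_
  have h := hasDerivAt_integral_of_dominated_loc_of_deriv_le (μ := m)
    (F := fun (u : ℂ) (z : ℝ × ℝ) => Complex.exp (u * (z.1 : ℂ)) - 1 - u * (z.1 : ℂ))
    (F' := fun (u : ℂ) (z : ℝ × ℝ) => (z.1 : ℂ) * (Complex.exp (u * (z.1 : ℂ)) - 1))
    (bound := fun z => (2 + (‖u‖ + 1)) * min z.1 (z.1 ^ 2))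
    (eventually_re_neg_norm_lt hu)
    (Eventually.of_forall fun w => by fun_prop)
    (integrable_exp_mul_sub_one_sub hm0 hm hu.le) (by fun_prop) ?_ (hm.const_mul _) ?_
  · exact h.2.differentiableAt
  · filter_upwards [hm0] with z hz w hw
    refine (norm_mul_exp_mul_sub_one_le hw.1.le hz).trans ?_
    have : 0 ≤ min z.1 (z.1 ^ 2) := le_min hz (sq_nonneg _)
    have := hw.2.le
    gcongr
  · refine Eventually.of_forall fun z w _ => ?_
    have h1 : HasDerivAt (fun u : ℂ => u * (z.1 : ℂ)) (z.1 : ℂ) w := by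
      simpa using (hasDerivAt_id w).mul_const (z.1 : ℂ)
    refine ((h1.cexp.sub_const 1).sub h1).congr_deriv ?_
    ring

lemma differentiableAt_immigration (hn0 : ∀ᵐ z ∂n, 0 ≤ z.1)
    (hn : Integrable (fun z : ℝ × ℝ => z.1) n) {u : ℂ} (hu : u.re < 0) :
    DifferentiableAt ℂ (immigration a n) u := by
  refine DifferentiableAt.add (by fun_prop) ?_
  have h := hasDerivAt_integral_of_dominated_loc_of_deriv_le (μ := n)
    (F := fun (u : ℂ) (z : ℝ × ℝ) => Complex.exp (u * (z.1 : ℂ)) - 1)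
    (F' := fun (u : ℂ) (z : ℝ × ℝ) => Complex.exp (u * (z.1 : ℂ)) * (z.1 : ℂ))
    (bound := fun z => z.1)
    (eventually_re_neg_norm_lt hu)
    (Eventually.of_forall fun w => by fun_prop)
    (integrable_exp_mul_sub_one hn0 hn hu.le) (by fun_prop) ?_ hn ?_
  · exact h.2.differentiableAt
  · filter_upwards [hn0] with z hz w hw
    rw [norm_mul, Complex.norm_exp, Complex.norm_real, Real.norm_of_nonneg hz]
    exact mul_le_of_le_one_left hz (Real.exp_le_one_iff.2 (mul_ofReal_re_nonpos hw.1.le hz))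
  · refine Eventually.of_forall fun z w _ => ?_
    have h1 : HasDerivAt (fun u : ℂ => u * (z.1 : ℂ)) (z.1 : ℂ) w := by
      simpa using (hasDerivAt_id w).mul_const (z.1 : ℂ)
    exact h1.cexp.sub_const 1

lemma norm_immigration_le (ha : 0 ≤ a) (hn0 : ∀ᵐ z ∂n, 0 ≤ z.1)
    (hn : Integrable (fun z : ℝ × ℝ => z.1) n) {u : ℂ} (hu : u.re ≤ 0) :
    ‖immigration a n u‖ ≤ (a + ∫ z, z.1 ∂n) * ‖u‖ := by
  have h : ‖∫ z : ℝ × ℝ, (Complex.exp (u * (z.1 : ℂ)) - 1) ∂n‖ ≤ ∫ z : ℝ × ℝ, ‖u‖ * z.1 ∂n := by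
    refine norm_integral_le_of_norm_le (hn.const_mul _) ?_
    filter_upwards [hn0] with z hz using norm_exp_mul_sub_one_le hu hz
  rw [integral_const_mul] at h
  refine (norm_add_le _ _).trans ?_
  rw [norm_mul, Complex.norm_real, Real.norm_of_nonneg ha]
  linarith

lemma re_branching_mul_conj_le (hα : 0 ≤ α) (hm0 : ∀ᵐ z ∂m, 0 ≤ z.1)
    (hm : Integrable (fun z : ℝ × ℝ => min z.1 (z.1 ^ 2)) m) {u : ℂ} (hu : u.re ≤ 0) :
    (branching a α m u * (starRingEnd ℂ) u).re ≤ -a * ‖u‖ ^ 2 := by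
  have hi := integrable_exp_mul_sub_one_sub hm0 hm hu
  have h1 : ((∫ z : ℝ × ℝ, (Complex.exp (u * (z.1 : ℂ)) - 1 - u * (z.1 : ℂ)) ∂m)
      * (starRingEnd ℂ) u).re ≤ 0 := by
    rw [← integral_mul_const]
    have := integral_re (hi.mul_const ((starRingEnd ℂ) u))
    simp only [RCLike.re_eq_complex_re] at this
    rw [← this]
    refine integral_nonpos_of_ae ?_
    filter_upwards [hm0] with z hz
    rcases hz.eq_or_lt with h0 | hpos
    · simp [← h0]
    · have h := re_exp_sub_one_sub_self_mul_conj_nonpos (mul_ofReal_re_nonpos hu hz)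
      rw [map_mul, Complex.conj_ofReal, ← mul_assoc, Complex.re_mul_ofReal] at h
      exact nonpos_of_mul_nonpos_left h hpos
  have h2 : u * (starRingEnd ℂ) u = ((‖u‖ ^ 2 : ℝ) : ℂ) := by
    rw [Complex.mul_conj, Complex.normSq_eq_norm_sq]
  have h3 : (branching a α m u * (starRingEnd ℂ) u) =
      ((-a * ‖u‖ ^ 2 : ℝ) : ℂ) + u * ((α * ‖u‖ ^ 2 : ℝ) : ℂ)
      + (∫ z : ℝ × ℝ, (Complex.exp (u * (z.1 : ℂ)) - 1 - u * (z.1 : ℂ)) ∂m)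
      * (starRingEnd ℂ) u := by
    rw [branching]
    push_cast at h2 ⊢
    linear_combination (-(a : ℂ) + α * u) * h2
  rw [h3, Complex.add_re, Complex.add_re, Complex.ofReal_re, Complex.re_mul_ofReal]
  have : u.re * (α * ‖u‖ ^ 2) ≤ 0 := mul_nonpos_of_nonpos_of_nonneg hu (by positivity)
  linarith

lemma mul_norm_le_norm_branching (hα : 0 ≤ α) (hm0 : ∀ᵐ z ∂m, 0 ≤ z.1)
    (hm : Integrable (fun z : ℝ × ℝ => min z.1 (z.1 ^ 2)) m) {u : ℂ} (hu : u.re ≤ 0) :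
    a * ‖u‖ ≤ ‖branching a α m u‖ := by
  rcases eq_or_ne u 0 with rfl | hne
  · simp
  have h := re_branching_mul_conj_le (a := a) hα hm0 hm hu
  have h2 := Complex.abs_re_le_norm (branching a α m u * (starRingEnd ℂ) u)
  rw [norm_mul, Complex.norm_conj] at h2
  have h3 := neg_abs_le (branching a α m u * (starRingEnd ℂ) u).re
  have hp : 0 < ‖u‖ := norm_pos_iff.2 hne
  refine le_of_mul_le_mul_right ?_ hp
  nlinarith

lemma branching_zero : branching a α m 0 = 0 := by simp [branching]

lemma immigration_zero : immigration a n 0 = 0 := by simp [immigration]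

end Mechanisms

/-! ### Primitives along rays of bounded functions on the left half-plane -/

/-- The integral of `k` along the segment from `0` to `u`. -/
def radialPrimitive (k : ℂ → ℂ) (u : ℂ) : ℂ := ∫ r in (0 : ℝ)..1, u * k (r * u)

lemma ofReal_mul_re_nonpos {u : ℂ} (hu : u.re ≤ 0) {r : ℝ} (hr : 0 ≤ r) :
    ((r : ℂ) * u).re ≤ 0 := by
  rw [Complex.re_ofReal_mul]
  exact mul_nonpos_of_nonneg_of_nonpos hr hu

section RadialPrimitive

variable {k : ℂ → ℂ} {B : ℝ}

lemma norm_radialPrimitive_le (hB : ∀ u : ℂ, u.re ≤ 0 → ‖k u‖ ≤ B) {u : ℂ} (hu : u.re ≤ 0) :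
    ‖radialPrimitive k u‖ ≤ B * ‖u‖ := by
  have h := intervalIntegral.norm_integral_le_of_norm_le_const (a := (0 : ℝ)) (b := 1)
    (f := fun r : ℝ => u * k (r * u)) (C := B * ‖u‖) (fun r hr => by
      rw [uIoc_of_le zero_le_one] at hr
      rw [norm_mul, mul_comm]
      gcongr
      exact hB _ (ofReal_mul_re_nonpos hu hr.1.le))
  rwa [sub_zero, abs_one, mul_one] at h

lemma radialPrimitive_zero : radialPrimitive k 0 = 0 := by simp [radialPrimitive]

lemma continuousOn_ray (hc : ContinuousOn k ({u | u.re ≤ 0} \ {0})) {u : ℂ} (hu : u.re ≤ 0)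
    (hu0 : u ≠ 0) : ContinuousOn (fun r : ℝ => k (r * u)) (Ioc 0 1) := by
  refine hc.comp (by fun_prop) fun r hr => ⟨ofReal_mul_re_nonpos hu hr.1.le, ?_⟩
  simpa using ⟨hr.1.ne', hu0⟩

lemma aestronglyMeasurable_ray (hc : ContinuousOn k ({u | u.re ≤ 0} \ {0})) {u : ℂ}
    (hu : u.re ≤ 0) :
    AEStronglyMeasurable (fun r : ℝ => k (r * u)) (volume.restrict (uIoc (0 : ℝ) 1)) := by
  rw [uIoc_of_le zero_le_one]
  rcases eq_or_ne u 0 with rfl | hu0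
  · simpa using aestronglyMeasurable_const
  · exact (continuousOn_ray hc hu hu0).aestronglyMeasurable measurableSet_Ioc

lemma continuousOn_radialPrimitive (hB : ∀ u : ℂ, u.re ≤ 0 → ‖k u‖ ≤ B)
    (hc : ContinuousOn k ({u | u.re ≤ 0} \ {0})) :
    ContinuousOn (radialPrimitive k) {u | u.re ≤ 0} := by
  intro u hu
  have hB0 : 0 ≤ B := (norm_nonneg _).trans (hB 0 (by simp))
  rcases eq_or_ne u 0 with rfl | hu0
  · rw [ContinuousWithinAt, radialPrimitive_zero]
    have h0 : Tendsto (fun w : ℂ => B * ‖w‖) (𝓝[{u | u.re ≤ 0}] 0) (𝓝 0) := by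
      refine Tendsto.mono_left ?_ nhdsWithin_le_nhds
      exact Continuous.tendsto' (by fun_prop) _ _ (by simp)
    refine squeeze_zero_norm' ?_ h0
    filter_upwards [self_mem_nhdsWithin] with w hw using norm_radialPrimitive_le hB hw
  · refine intervalIntegral.continuousWithinAt_of_dominated_interval
      (bound := fun _ => (‖u‖ + 1) * B) ?_ ?_ intervalIntegrable_const ?_
    · filter_upwards [self_mem_nhdsWithin] with w hw
      exact aestronglyMeasurable_const.mul (aestronglyMeasurable_ray hc hw)
    · have h1 : ∀ᶠ w in 𝓝[{u | u.re ≤ 0}] u, ‖w‖ < ‖u‖ + 1 :=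
        nhdsWithin_le_nhds ((isOpen_lt continuous_norm continuous_const).mem_nhds (by simp))
      filter_upwards [h1, self_mem_nhdsWithin] with w hw hw0
      refine Eventually.of_forall fun r hr => ?_
      rw [uIoc_of_le zero_le_one] at hr
      rw [norm_mul]
      gcongr
      exact hB _ (ofReal_mul_re_nonpos hw0 hr.1.le)
    · refine Eventually.of_forall fun r hr => ?_
      rw [uIoc_of_le zero_le_one] at hr
      refine continuousWithinAt_id.mul ?_
      have hmem : (r : ℂ) * u ∈ {u : ℂ | u.re ≤ 0} \ {0} :=
        ⟨ofReal_mul_re_nonpos hu hr.1.le, by simpa using ⟨hr.1.ne', hu0⟩⟩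
      have hk := hc _ hmem
      have ht : Tendsto (fun w : ℂ => (r : ℂ) * w) (𝓝[{u | u.re ≤ 0}] u)
          (𝓝[{u | u.re ≤ 0} \ {0}] ((r : ℂ) * u)) := by
        refine tendsto_nhdsWithin_iff.2 ⟨?_, ?_⟩
        · exact Tendsto.mono_left (Continuous.tendsto (by fun_prop) _) nhdsWithin_le_nhds
        · have h1 : ∀ᶠ w in 𝓝[{u | u.re ≤ 0}] u, w ≠ 0 :=
            nhdsWithin_le_nhds (isOpen_ne.mem_nhds hu0)
          filter_upwards [h1, self_mem_nhdsWithin] with w hw hw0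
          exact ⟨ofReal_mul_re_nonpos hw0 hr.1.le, by simpa using ⟨hr.1.ne', hw⟩⟩
      exact hk.tendsto.comp ht

lemma norm_deriv_le_of_re_neg (hB : ∀ u : ℂ, u.re ≤ 0 → ‖k u‖ ≤ B)
    (hd : ∀ u : ℂ, u.re < 0 → DifferentiableAt ℂ k u) {u : ℂ} (hu : u.re < 0) :
    ‖deriv k u‖ ≤ 2 * B / (-u.re) := by
  have hsub : ∀ w ∈ Metric.closedBall u (-u.re / 2), w.re < 0 := by
    intro w hw
    have h1 : |(w - u).re| ≤ -u.re / 2 :=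
      (Complex.abs_re_le_norm _).trans (by simpa [dist_eq_norm] using hw)
    rw [Complex.sub_re] at h1
    linarith [(abs_le.1 h1).2]
  have h := Complex.norm_deriv_le_of_forall_mem_sphere_norm_le (f := k) (c := u)
    (R := -u.re / 2) (C := B) (by linarith) ?_ ?_
  · refine h.trans_eq ?_
    have : -u.re ≠ 0 := by linarith
    field_simp
  · refine DifferentiableOn.diffContOnCl fun w hw => ?_
    exact (hd w (hsub w (Metric.closure_ball_subset_closedBall hw))).differentiableWithinAt
  · intro w hw
    exact hB w (hsub w (Metric.sphere_subset_closedBall hw)).le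

lemma hasDerivAt_radialPrimitive (hB : ∀ u : ℂ, u.re ≤ 0 → ‖k u‖ ≤ B)
    (hc : ContinuousOn k ({u | u.re ≤ 0} \ {0}))
    (hd : ∀ u : ℂ, u.re < 0 → DifferentiableAt ℂ k u) {u : ℂ} (hu : u.re < 0) :
    HasDerivAt (radialPrimitive k) (k u) u := by
  have hB0 : 0 ≤ B := (norm_nonneg _).trans (hB 0 (by simp))
  have hu0 : u ≠ 0 := by
    rintro rfl
    simp at hu
  set s : Set ℂ := {w : ℂ | w.re < u.re / 2 ∧ ‖w‖ < ‖u‖ + 1}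
  have hs : s ∈ 𝓝 u :=
    ((isOpen_lt Complex.continuous_re continuous_const).inter
      (isOpen_lt continuous_norm continuous_const)).mem_nhds
        ⟨show u.re < u.re / 2 by linarith, by simp⟩
  have hs0 : ∀ w ∈ s, w.re < 0 := fun w hw => by linarith [hw.1]
  have hneg : ∀ w : ℂ, w.re < 0 → ∀ r : ℝ, 0 < r → ((r : ℂ) * w).re < 0 := by
    intro w hw r hr
    rw [Complex.re_ofReal_mul]
    exact mul_neg_of_pos_of_neg hr hw
  have hkd : ContinuousOn (deriv k) {w | w.re < 0} := by
    have hD : DifferentiableOn ℂ k {w | w.re < 0} :=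
      fun w hw => (hd w hw).differentiableWithinAt
    exact (hD.deriv (isOpen_lt Complex.continuous_re continuous_const)).continuousOn
  have hI : uIoc (0 : ℝ) 1 = Ioc 0 1 := uIoc_of_le zero_le_one
  have h := intervalIntegral.hasDerivAt_integral_of_dominated_loc_of_deriv_le
    (μ := volume) (a := (0 : ℝ)) (b := 1)
    (F := fun (w : ℂ) (r : ℝ) => w * k (r * w))
    (F' := fun (w : ℂ) (r : ℝ) => k (r * w) + w * (deriv k (r * w) * r))
    (bound := fun _ => B + (‖u‖ + 1) * (2 * B / (-u.re / 2))) hs ?_ ?_ ?_ ?_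
    intervalIntegrable_const ?_
  · refine h.2.congr_deriv ?_
    have hftc := intervalIntegral.integral_eq_sub_of_hasDerivAt_of_le (a := (0 : ℝ)) (b := 1)
      (f := fun r : ℝ => (r : ℂ) * k (r * u))
      (f' := fun r : ℝ => k (r * u) + u * (deriv k (r * u) * r)) zero_le_one ?_ ?_ h.1
    · rw [hftc]
      simp
    · intro r hr
      rcases hr.1.eq_or_lt with rfl | hpos
      · rw [ContinuousWithinAt]
        have h0 : Tendsto (fun x : ℝ => |x| * B) (𝓝[Icc (0 : ℝ) 1] 0) (𝓝 0) := by
          refine Tendsto.mono_left ?_ nhdsWithin_le_nhds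
          exact Continuous.tendsto' (by fun_prop) _ _ (by simp)
        simp only [Complex.ofReal_zero, zero_mul]
        refine squeeze_zero_norm' ?_ h0
        filter_upwards [self_mem_nhdsWithin] with x hx
        rw [norm_mul, Complex.norm_real, Real.norm_eq_abs]
        gcongr
        exact hB _ (ofReal_mul_re_nonpos hu.le hx.1)
      · refine ContinuousAt.continuousWithinAt ?_
        refine ContinuousAt.mul (by fun_prop) ?_
        exact ContinuousAt.comp (g := k) (hd _ (hneg u hu r hpos)).continuousAt (by fun_prop)
    · intro r hr
      have h1 : HasDerivAt (fun x : ℝ => (x : ℂ)) 1 r := Complex.ofRealCLM.hasDerivAt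
      have h2 : HasDerivAt (fun x : ℝ => (x : ℂ) * u) u r := by simpa using h1.mul_const u
      have h3 := (hd _ (hneg u hu r hr.1)).hasDerivAt.comp r h2
      refine (h1.mul h3).congr_deriv ?_
      simp only [Function.comp]
      ring
  · filter_upwards [hs] with w hw
    exact aestronglyMeasurable_const.mul (aestronglyMeasurable_ray hc (hs0 w hw).le)
  · refine (intervalIntegrable_const (c := ‖u‖ * B)).mono_fun'
      (aestronglyMeasurable_const.mul (aestronglyMeasurable_ray hc hu.le)) ?_
    rw [hI]
    filter_upwards [ae_restrict_mem measurableSet_Ioc] with r hr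
    rw [norm_mul]
    gcongr
    exact hB _ (ofReal_mul_re_nonpos hu.le hr.1.le)
  · refine (aestronglyMeasurable_ray hc hu.le).add (aestronglyMeasurable_const.mul ?_)
    rw [hI]
    refine ContinuousOn.aestronglyMeasurable ?_ measurableSet_Ioc
    exact (hkd.comp (by fun_prop) fun r hr => hneg u hu r hr.1).mul (by fun_prop)
  · refine Eventually.of_forall fun r hr w hw => ?_
    rw [hI] at hr
    have hw0 := hs0 w hw
    have hneg' := hneg w hw0 r hr.1
    refine (norm_add_le _ _).trans (add_le_add (hB _ hneg'.le) ?_)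
    rw [norm_mul, norm_mul, Complex.norm_real, Real.norm_of_nonneg hr.1.le]
    have h1 : ‖deriv k (r * w)‖ * r ≤ 2 * B / (-u.re / 2) := by
      have h2 := mul_le_mul_of_nonneg_right (norm_deriv_le_of_re_neg hB hd hneg') hr.1.le
      refine h2.trans ?_
      rw [Complex.re_ofReal_mul]
      have : 2 * B / -(r * w.re) * r = 2 * B / (-w.re) := by
        have := hr.1.ne'
        have := hw0.ne
        field_simp
      rw [this]
      have := hw.1
      gcongr <;> linarith
    have := hw.2.le
    have := hr.1.le
    have h0 : 0 ≤ ‖deriv k (r * w)‖ * r := by positivity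
    gcongr
  · refine Eventually.of_forall fun r hr w hw => ?_
    rw [hI] at hr
    have h2 : HasDerivAt (fun x : ℂ => (r : ℂ) * x) r w := by
      simpa using (hasDerivAt_id w).const_mul (r : ℂ)
    have h3 := (hd _ (hneg w (hs0 w hw) r hr.1)).hasDerivAt.comp w h2
    refine ((hasDerivAt_id w).mul h3).congr_deriv ?_
    simp

/-- Fundamental theorem of calculus for `radialPrimitive` along a curve in the closed left
half-plane, which is allowed to run along the boundary. -/
lemma integral_mul_deriv_eq_radialPrimitive_sub (hB : ∀ u : ℂ, u.re ≤ 0 → ‖k u‖ ≤ B)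
    (hc : ContinuousOn k ({u | u.re ≤ 0} \ {0}))
    (hd : ∀ u : ℂ, u.re < 0 → DifferentiableAt ℂ k u)
    {v v' : ℝ → ℂ} {T : ℝ} (hT : 0 ≤ T) (hv : ∀ t ∈ Icc 0 T, (v t).re ≤ 0)
    (hv' : ∀ t ∈ Icc 0 T, HasDerivAt v (v' t) t) (hcont : ContinuousOn v' (Icc 0 T))
    (hzero : ∀ t ∈ Icc 0 T, v t = 0 → v' t = 0) :
    ∫ t in (0 : ℝ)..T, k (v t) * v' t = radialPrimitive k (v T) - radialPrimitive k (v 0) := by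
  have hB0 : 0 ≤ B := (norm_nonneg _).trans (hB 0 (by simp))
  have hshift : ∀ w : ℂ, w.re ≤ 0 → ∀ ε : ℝ, 0 < ε → (w - ε).re < 0 := by
    intro w hw ε hε
    rw [Complex.sub_re, Complex.ofReal_re]
    linarith
  have hvc : ContinuousOn v (Icc 0 T) := fun t ht => (hv' t ht).continuousAt.continuousWithinAt
  have hkc : ∀ ε : ℝ, 0 < ε → ContinuousOn (fun t => k (v t - ε) * v' t) (Icc 0 T) := by
    intro ε hε t ht
    refine ContinuousWithinAt.mul ?_ (hcont t ht)
    exact ContinuousAt.comp_continuousWithinAt (g := k)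
      (hd _ (hshift _ (hv t ht) ε hε)).continuousAt ((hvc t ht).sub continuousWithinAt_const)
  have hsh : ∀ ε : ℝ, 0 < ε → ∫ t in (0 : ℝ)..T, k (v t - ε) * v' t =
      radialPrimitive k (v T - ε) - radialPrimitive k (v 0 - ε) := by
    intro ε hε
    refine intervalIntegral.integral_eq_sub_of_hasDerivAt
      (f := fun t => radialPrimitive k (v t - ε)) (fun t ht => ?_) ?_
    · rw [uIcc_of_le hT] at ht
      exact (hasDerivAt_radialPrimitive hB hc hd (hshift _ (hv t ht) ε hε)).comp t
        ((hv' t ht).sub_const _)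
    · exact ContinuousOn.intervalIntegrable (by rw [uIcc_of_le hT]; exact hkc ε hε)
  have htend : ∀ w : ℂ, w.re ≤ 0 →
      Tendsto (fun ε : ℝ => w - (ε : ℂ)) (𝓝[>] 0) (𝓝[{u | u.re ≤ 0}] w) := by
    intro w hw
    refine tendsto_nhdsWithin_iff.2 ⟨?_, ?_⟩
    · refine Tendsto.mono_left ?_ nhdsWithin_le_nhds
      exact Continuous.tendsto' (by fun_prop) _ _ (by simp)
    · filter_upwards [self_mem_nhdsWithin] with ε hε using (hshift w hw ε hε).le
  have hlimR : Tendsto (fun ε : ℝ => radialPrimitive k (v T - ε) - radialPrimitive k (v 0 - ε))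
      (𝓝[>] 0) (𝓝 (radialPrimitive k (v T) - radialPrimitive k (v 0))) := by
    have hK := continuousOn_radialPrimitive hB hc
    have h1 := hv T ⟨hT, le_rfl⟩
    have h2 := hv 0 ⟨le_rfl, hT⟩
    exact ((hK _ h1).tendsto.comp (htend _ h1)).sub ((hK _ h2).tendsto.comp (htend _ h2))
  have hlimL : Tendsto (fun ε : ℝ => ∫ t in (0 : ℝ)..T, k (v t - ε) * v' t)
      (𝓝[>] 0) (𝓝 (∫ t in (0 : ℝ)..T, k (v t) * v' t)) := by
    refine intervalIntegral.tendsto_integral_filter_of_dominated_convergence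
      (fun t => B * ‖v' t‖) ?_ ?_ ?_ ?_
    · filter_upwards [self_mem_nhdsWithin] with ε hε
      rw [uIoc_of_le hT]
      exact ((hkc ε hε).mono Ioc_subset_Icc_self).aestronglyMeasurable measurableSet_Ioc
    · filter_upwards [self_mem_nhdsWithin] with ε hε
      refine Eventually.of_forall fun t ht => ?_
      rw [uIoc_of_le hT] at ht
      rw [norm_mul]
      gcongr
      exact hB _ (hshift _ (hv t (Ioc_subset_Icc_self ht)) ε hε).le
    · refine ContinuousOn.intervalIntegrable ?_
      rw [uIcc_of_le hT]
      exact continuousOn_const.mul hcont.norm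
    · refine Eventually.of_forall fun t ht => ?_
      rw [uIoc_of_le hT] at ht
      have ht' := Ioc_subset_Icc_self ht
      rcases eq_or_ne (v t) 0 with h0 | h0
      · simp [hzero t ht' h0]
      · refine Tendsto.mul_const _ ?_
        have hk : ContinuousWithinAt k ({u | u.re ≤ 0} \ {0}) (v t) := hc _ ⟨hv t ht', h0⟩
        refine hk.tendsto.comp (tendsto_nhdsWithin_iff.2
          ⟨tendsto_nhds_of_tendsto_nhdsWithin (htend _ (hv t ht')), ?_⟩)
        filter_upwards [self_mem_nhdsWithin] with ε hε
        have hlt := hshift _ (hv t ht') ε hε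
        refine ⟨hlt.le, fun h => ?_⟩
        rw [mem_singleton_iff] at h
        rw [h] at hlt
        simp at hlt
  refine tendsto_nhds_unique hlimL (hlimR.congr' ?_)
  filter_upwards [self_mem_nhdsWithin] with ε hε using (hsh ε hε).symm

end RadialPrimitive

/-! ### Decay of the flow and identification of the Laplace transform -/

lemma norm_flow_le {a α : ℝ} {m : Measure (ℝ × ℝ)} (hα : 0 ≤ α) (hm0 : ∀ᵐ z ∂m, 0 ≤ z.1)
    (hm : Integrable (fun z : ℝ × ℝ => min z.1 (z.1 ^ 2)) m) {v : ℝ → ℂ}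
    (hv : ∀ t, 0 ≤ t → (v t).re ≤ 0)
    (hv' : ∀ t, 0 ≤ t → HasDerivAt v (branching a α m (v t)) t) {t : ℝ} (ht : 0 ≤ t) :
    ‖v t‖ ≤ ‖v 0‖ * Real.exp (-a * t) := by
  have hder : ∀ s, 0 ≤ s → HasDerivAt (fun s => ‖v s‖ ^ 2 * Real.exp (2 * a * s))
      (2 * inner ℝ (v s) (branching a α m (v s)) * Real.exp (2 * a * s)
        + ‖v s‖ ^ 2 * (Real.exp (2 * a * s) * (2 * a))) s := by
    intro s hs
    have h1 : HasDerivAt (fun s : ℝ => 2 * a * s) (2 * a) s := by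
      simpa using (hasDerivAt_id s).const_mul (2 * a)
    exact (hv' s hs).norm_sq.mul h1.exp
  have hanti : AntitoneOn (fun s => ‖v s‖ ^ 2 * Real.exp (2 * a * s)) (Ici 0) := by
    refine antitoneOn_of_hasDerivWithinAt_nonpos (convex_Ici 0)
      (fun s hs => (hder s hs).continuousAt.continuousWithinAt)
      (fun s hs => (hder s (interior_subset hs)).hasDerivWithinAt) fun s hs => ?_
    have h := re_branching_mul_conj_le (a := a) hα hm0 hm (hv s (interior_subset hs))
    rw [Complex.inner]
    nlinarith [Real.exp_pos (2 * a * s)]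
  have h := hanti (mem_Ici.2 le_rfl) (mem_Ici.2 ht) ht
  simp only [mul_zero, Real.exp_zero, mul_one] at h
  refine le_of_sq_le_sq ?_ (by positivity)
  have he : Real.exp (-a * t) ^ 2 * Real.exp (2 * a * t) = 1 := by
    rw [sq, ← Real.exp_add, ← Real.exp_add, Real.exp_eq_one_iff]
    ring
  refine le_of_mul_le_mul_right ?_ (Real.exp_pos (2 * a * t))
  rwa [mul_pow, mul_assoc (‖v 0‖ ^ 2), he, mul_one]

lemma phi_mk_zero {a₁ b₁ α₁₁ α₁₂ α₂₁ α₂₂ : ℝ} {m : Measure (ℝ × ℝ)} (u : ℂ) :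
    phi a₁ b₁ α₁₁ α₁₂ α₂₁ α₂₂ m (u, 0) = branching a₁ (α₁₁ + α₁₂) m u := by
  simp [phi, branching]

lemma psi_mk_zero {a₂ b₀ σ : ℝ} {n : Measure (ℝ × ℝ)} (u : ℂ) :
    psi a₂ b₀ σ n (u, 0) = immigration a₂ n u := by
  simp [psi, immigration]

lemma immigration_ofReal {a : ℝ} {n : Measure (ℝ × ℝ)} (x : ℝ) :
    immigration a n x = (Pfun a n x : ℂ) := by
  rw [immigration, Pfun]
  push_cast
  rw [← integral_complex_ofReal]
  push_cast
  rfl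

lemma branching_ofReal {a α₁₁ α₁₂ : ℝ} {m : Measure (ℝ × ℝ)} (x : ℝ) :
    branching a (α₁₁ + α₁₂) m x = (tphi0 a α₁₁ α₁₂ m x : ℂ) := by
  rw [branching, tphi0]
  push_cast
  rw [← integral_complex_ofReal]
  push_cast
  rfl

lemma Pfun_nonpos {a : ℝ} {n : Measure (ℝ × ℝ)} (ha : 0 ≤ a) (hn0 : ∀ᵐ z ∂n, 0 ≤ z.1) {x : ℝ}
    (hx : x ≤ 0) : Pfun a n x ≤ 0 := by
  refine add_nonpos (mul_nonpos_of_nonneg_of_nonpos ha hx) (integral_nonpos_of_ae ?_)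
  filter_upwards [hn0] with z hz
  exact sub_nonpos.2 (Real.exp_le_one_iff.2 (mul_nonpos_of_nonpos_of_nonneg hx hz))

lemma tphi0_nonneg {a α₁₁ α₁₂ : ℝ} {m : Measure (ℝ × ℝ)} (ha : 0 ≤ a) (h₁ : 0 ≤ α₁₁)
    (h₂ : 0 ≤ α₁₂) {x : ℝ} (hx : x ≤ 0) : 0 ≤ tphi0 a α₁₁ α₁₂ m x := by
  refine add_nonneg (add_nonneg ?_ (by positivity)) (integral_nonneg fun z => ?_)
  · nlinarith
  · have := Real.add_one_le_exp (x * z.1)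
    simp only [Pi.zero_apply]
    linarith

lemma radialPrimitive_ofReal {k : ℂ → ℂ} {q : ℝ → ℝ} (hq : ∀ x : ℝ, k x = (q x : ℂ)) (u : ℝ) :
    radialPrimitive k u = -((∫ z in u..(0 : ℝ), q z : ℝ) : ℂ) := by
  have h := intervalIntegral.mul_integral_comp_mul_right (a := (0 : ℝ)) (b := 1) (f := q) u
  rw [zero_mul, one_mul] at h
  rw [intervalIntegral.integral_symm, ← h, radialPrimitive, ← intervalIntegral.integral_const_mul,
    ← Complex.ofReal_neg, neg_neg, ← intervalIntegral.integral_ofReal]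
  congr 1
  ext r
  rw [← Complex.ofReal_mul, hq]
  push_cast
  rfl

/-- Two functions which are bounded, respectively of exponential type, on the left half-plane
agree there if they agree on the imaginary axis. -/
lemma eqOn_left_half_plane {L G : ℂ → ℂ} {B C : ℝ}
    (hL : DiffContOnCl ℂ L {u | u.re < 0}) (hG : DiffContOnCl ℂ G {u | u.re < 0})
    (hLb : ∀ u : ℂ, u.re ≤ 0 → ‖L u‖ ≤ 1) (hB : 0 ≤ B)
    (hGb : ∀ u : ℂ, u.re ≤ 0 → ‖G u‖ ≤ Real.exp (B * ‖u‖))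
    (hGr : ∀ x : ℝ, x ≤ 0 → ‖G x‖ ≤ C)
    (him : ∀ θ : ℝ, L (θ * Complex.I) = G (θ * Complex.I)) {u : ℂ} (hu : u.re ≤ 0) :
    L u = G u := by
  have hneg : MapsTo (fun z : ℂ => -z) {z | 0 < z.re} {u | u.re < 0} := by
    intro z hz
    simpa using hz
  have hd : DiffContOnCl ℂ (fun z => L (-z) - G (-z)) {z | 0 < z.re} :=
    (hL.comp differentiable_neg.diffContOnCl hneg).sub
      (hG.comp differentiable_neg.diffContOnCl hneg)
  have h := PhragmenLindelof.right_half_plane_of_bounded_on_real (C := 0) (z := -u) hd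
    ⟨1, by norm_num, B, ?_⟩ ?_ (fun θ => ?_) (by simpa using hu)
  · rw [neg_neg, norm_le_zero_iff] at h
    exact sub_eq_zero.1 h
  · refine Asymptotics.IsBigO.of_bound 2 ?_
    filter_upwards [mem_inf_of_right (mem_principal_self _)] with z hz
    have hz' : (-z).re ≤ 0 := by simpa using (show 0 < z.re from hz).le
    have h1 := hLb _ hz'
    have h2 := hGb _ hz'
    rw [norm_neg] at h2
    rw [Real.rpow_one, Real.norm_of_nonneg (Real.exp_pos _).le]
    have h3 : 1 ≤ Real.exp (B * ‖z‖) := Real.one_le_exp (by positivity)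
    have := norm_sub_le (L (-z)) (G (-z))
    linarith
  · refine ⟨1 + C, ?_⟩
    rw [eventually_map]
    filter_upwards [eventually_ge_atTop 0] with x hx
    have h1 := hLb (-(x : ℂ)) (by simpa using hx)
    have h2 := hGr (-x) (by linarith)
    rw [Complex.ofReal_neg] at h2
    have := norm_sub_le (L (-(x : ℂ))) (G (-(x : ℂ)))
    linarith
  · have := him (-θ)
    rw [Complex.ofReal_neg, neg_mul] at this
    rw [this, sub_self, norm_zero]

section LaplaceTransform

variable {π : Measure (ℝ × ℝ)} [IsProbabilityMeasure π]

lemma norm_exp_mul_ofReal_le_one {u : ℂ} (hu : u.re ≤ 0) {x : ℝ} (hx : 0 ≤ x) :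
    ‖Complex.exp (u * x)‖ ≤ 1 := by
  rw [Complex.norm_exp]
  exact Real.exp_le_one_iff.2 (mul_ofReal_re_nonpos hu hx)

lemma norm_laplace_le_one (hπ : ∀ᵐ y ∂π, 0 ≤ y.1) {u : ℂ} (hu : u.re ≤ 0) :
    ‖∫ y : ℝ × ℝ, Complex.exp (u * (y.1 : ℂ)) ∂π‖ ≤ 1 := by
  refine (norm_integral_le_of_norm_le_const (C := 1) ?_).trans_eq (by simp)
  filter_upwards [hπ] with y hy using norm_exp_mul_ofReal_le_one hu hy

lemma diffContOnCl_laplace (hπ : ∀ᵐ y ∂π, 0 ≤ y.1) :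
    DiffContOnCl ℂ (fun u : ℂ => ∫ y : ℝ × ℝ, Complex.exp (u * (y.1 : ℂ)) ∂π)
      {u | u.re < 0} := by
  refine ⟨fun u hu => ?_, ?_⟩
  · have hint : Iic 0 ⊆ ProbabilityTheory.integrableExpSet (fun y : ℝ × ℝ => y.1) π := by
      intro x hx
      refine (integrable_const (1 : ℝ)).mono' (by fun_prop) ?_
      filter_upwards [hπ] with y hy
      rw [Real.norm_of_nonneg (Real.exp_pos _).le]
      exact Real.exp_le_one_iff.2 (mul_nonpos_of_nonpos_of_nonneg hx hy)
    have hmem : u.re ∈ interior (ProbabilityTheory.integrableExpSet (fun y : ℝ × ℝ => y.1) π) := by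
      refine interior_mono hint ?_
      rw [interior_Iic]
      exact hu
    exact (ProbabilityTheory.hasDerivAt_complexMGF hmem).differentiableAt.differentiableWithinAt
  · rw [Complex.closure_setOfPred_re_lt]
    refine continuousOn_of_dominated (bound := fun _ => 1) (fun u _ => by fun_prop) ?_
      (integrable_const _) (Eventually.of_forall fun y => by fun_prop)
    intro u hu
    filter_upwards [hπ] with y hy using norm_exp_mul_ofReal_le_one hu hy

end LaplaceTransform

/-- Fubini formula for integrals against a `bind` along a measurable family of measures. -/
lemma integral_bind_of_integrable {α β : Type*} [MeasurableSpace α] [MeasurableSpace β]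
    {μ : Measure α} {κ : α → Measure β} (hκ : Measurable κ) {f : β → ℂ}
    (hf : Integrable f (μ.bind κ)) : ∫ y, f y ∂(μ.bind κ) = ∫ x, ∫ y, f y ∂(κ x) ∂μ := by
  have h := ProbabilityTheory.Kernel.integral_comp (κ := ProbabilityTheory.Kernel.const Unit μ)
    (η := ⟨κ, hκ⟩) (a := ()) (f := f)
  simp only [ProbabilityTheory.Kernel.comp_apply, ProbabilityTheory.Kernel.const_apply] at h
  exact h hf

namespace AffineSemigroup

variable (S : AffineSemigroup)

lemma ae_m_nonneg : ∀ᵐ z ∂S.m, 0 ≤ z.1 := by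
  refine measure_mono_null (fun z hz => ?_) S.m_supp
  exact Or.inl (not_le.1 hz)

lemma ae_n_nonneg : ∀ᵐ z ∂S.n, 0 ≤ z.1 := by
  refine measure_mono_null (fun z hz => ?_) S.n_supp
  exact Or.inl (not_le.1 hz)

lemma integrable_m : Integrable (fun z : ℝ × ℝ => min z.1 (z.1 ^ 2)) S.m := by
  refine ⟨by fun_prop, ?_⟩
  rw [hasFiniteIntegral_iff_norm]
  refine (lintegral_mono_ae ?_).trans_lt S.m_int
  filter_upwards [S.ae_m_nonneg] with z hz
  rw [Real.norm_of_nonneg (le_min hz (sq_nonneg _))]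
  exact ENNReal.ofReal_le_ofReal (le_add_of_nonneg_right (sq_nonneg _))

lemma integrable_n (hz₁ : ∫⁻ z in {z : ℝ × ℝ | 1 < z.1}, ENNReal.ofReal z.1 ∂S.n < ⊤) :
    Integrable (fun z : ℝ × ℝ => z.1) S.n := by
  refine ⟨by fun_prop, ?_⟩
  rw [hasFiniteIntegral_iff_norm]
  have hmeas : MeasurableSet {z : ℝ × ℝ | 1 < z.1} := measurableSet_lt (by fun_prop) (by fun_prop)
  rw [← lintegral_add_compl _ hmeas]
  refine ENNReal.add_lt_top.2 ⟨lt_of_le_of_lt (lintegral_mono_ae ?_) hz₁, ?_⟩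
  · filter_upwards [ae_restrict_of_ae S.ae_n_nonneg] with z hz
    rw [Real.norm_of_nonneg hz]
  · refine lt_of_le_of_lt (le_trans (lintegral_mono_ae ?_) (setLIntegral_le_lintegral _ _)) S.n_int
    filter_upwards [ae_restrict_of_ae S.ae_n_nonneg, ae_restrict_mem hmeas.compl] with z hz hz1
    have hle : z.1 ≤ 1 := not_lt.1 hz1
    rw [Real.norm_of_nonneg hz, min_eq_right hle]
    exact ENNReal.ofReal_le_ofReal
      (le_add_of_nonneg_right (le_min (abs_nonneg _) (sq_nonneg _)))

/-- The ratio `ψ(u, 0) / φ(u, 0)` of the immigration and the branching mechanism. -/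
def ratio (u : ℂ) : ℂ := immigration S.a₂ S.n u / branching S.a₁ (S.α₁₁ + S.α₁₂) S.m u


variable {S}

lemma branching_ne_zero (ha₁ : 0 < S.a₁) {u : ℂ} (hu : u.re ≤ 0) (hu0 : u ≠ 0) :
    branching S.a₁ (S.α₁₁ + S.α₁₂) S.m u ≠ 0 := by
  have h := mul_norm_le_norm_branching (a := S.a₁) (add_nonneg S.α₁₁_nonneg S.α₁₂_nonneg)
    S.ae_m_nonneg S.integrable_m hu
  exact norm_pos_iff.1 ((mul_pos ha₁ (norm_pos_iff.2 hu0)).trans_le h)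

lemma norm_ratio_le (ha₁ : 0 < S.a₁)
    (hz₁ : ∫⁻ z in {z : ℝ × ℝ | 1 < z.1}, ENNReal.ofReal z.1 ∂S.n < ⊤)
    {u : ℂ} (hu : u.re ≤ 0) :
    ‖S.ratio u‖ ≤ (S.a₂ + ∫ z, z.1 ∂S.n) / S.a₁ := by
  have hC : 0 ≤ S.a₂ + ∫ z, z.1 ∂S.n :=
    add_nonneg S.a₂_nonneg (integral_nonneg_of_ae S.ae_n_nonneg)
  have h1 := norm_immigration_le S.a₂_nonneg S.ae_n_nonneg (S.integrable_n hz₁) hu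
  have h2 := mul_norm_le_norm_branching (a := S.a₁) (add_nonneg S.α₁₁_nonneg S.α₁₂_nonneg)
    S.ae_m_nonneg S.integrable_m hu
  rw [ratio, norm_div]
  refine div_le_of_le_mul₀ (norm_nonneg _) (by positivity) (h1.trans ?_)
  rw [div_mul_eq_mul_div, le_div_iff₀ ha₁, mul_assoc, mul_comm ‖u‖]
  gcongr

lemma continuousOn_ratio (ha₁ : 0 < S.a₁)
    (hz₁ : ∫⁻ z in {z : ℝ × ℝ | 1 < z.1}, ENNReal.ofReal z.1 ∂S.n < ⊤) :
    ContinuousOn S.ratio ({u | u.re ≤ 0} \ {0}) :=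
  ((continuousOn_immigration S.ae_n_nonneg (S.integrable_n hz₁)).mono sdiff_subset).div
    ((continuousOn_branching S.ae_m_nonneg S.integrable_m).mono sdiff_subset)
    fun _ hu => branching_ne_zero ha₁ hu.1 hu.2

lemma differentiableAt_ratio (ha₁ : 0 < S.a₁)
    (hz₁ : ∫⁻ z in {z : ℝ × ℝ | 1 < z.1}, ENNReal.ofReal z.1 ∂S.n < ⊤) {u : ℂ} (hu : u.re < 0) :
    DifferentiableAt ℂ S.ratio u := by
  refine (differentiableAt_immigration S.ae_n_nonneg (S.integrable_n hz₁) hu).div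
    (differentiableAt_branching S.ae_m_nonneg S.integrable_m hu)
    (branching_ne_zero ha₁ hu.le ?_)
  rintro rfl
  simp at hu

/-- The flow of the branching mechanism started on the imaginary axis contracts to `0`, and the
immigration mechanism integrated along it is an increment of the primitive of the ratio. -/
lemma exists_flow (ha₁ : 0 < S.a₁)
    (hz₁ : ∫⁻ z in {z : ℝ × ℝ | 1 < z.1}, ENNReal.ofReal z.1 ∂S.n < ⊤) {u : ℂ} (hu : u.re = 0) :
    ∃ v : ℝ → ℂ, (∀ t, 0 ≤ t → (v t).re ≤ 0) ∧ Tendsto v atTop (𝓝 0) ∧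
      ∀ t, 0 ≤ t → ∀ x : ℝ × ℝ, 0 ≤ x.1 →
        ∫ ξ : ℝ × ℝ, Complex.exp (u * (ξ.1 : ℂ)) ∂(S.P t x) = Complex.exp (v t * (x.1 : ℂ))
          * Complex.exp (radialPrimitive S.ratio (v t) - radialPrimitive S.ratio u) := by
  set v : ℝ → ℂ := fun t => S.V₁ t (u, 0) with hv_def
  have hα : 0 ≤ S.α₁₁ + S.α₁₂ := add_nonneg S.α₁₁_nonneg S.α₁₂_nonneg
  have hv : ∀ t, 0 ≤ t → (v t).re ≤ 0 := S.V₁_mem (u, 0) hu.le (by simp)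
  have hv0 : v 0 = u := S.V₁_init (u, 0)
  have hv' : ∀ t, 0 ≤ t → HasDerivAt v (branching S.a₁ (S.α₁₁ + S.α₁₂) S.m (v t)) t := by
    intro t ht
    have h := S.V₁_ode (u, 0) hu.le (by simp) t ht
    simp only [mul_zero, phi_mk_zero] at h
    exact h
  refine ⟨v, hv, ?_, fun t ht x hx => ?_⟩
  · have hlim : Tendsto (fun t : ℝ => ‖v 0‖ * Real.exp (-S.a₁ * t)) atTop (𝓝 0) := by
      have h1 : Tendsto (fun t : ℝ => -S.a₁ * t) atTop atBot :=
        tendsto_id.const_mul_atTop_of_neg (neg_lt_zero.2 ha₁)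
      simpa using (Real.tendsto_exp_atBot.comp h1).const_mul ‖v 0‖
    refine squeeze_zero_norm' ?_ hlim
    filter_upwards [eventually_ge_atTop 0] with t ht
    exact norm_flow_le hα S.ae_m_nonneg S.integrable_m hv hv' ht
  · have h := S.P_char t ht x hx (u, 0) hu (by simp)
    simp only [mul_zero, zero_mul, add_zero, psi_mk_zero] at h
    rw [h, Complex.exp_add, mul_comm (x.1 : ℂ)]
    congr 2
    have hvc : ContinuousOn v (Icc 0 t) :=
      fun s hs => (hv' s hs.1).continuousAt.continuousWithinAt
    have key := integral_mul_deriv_eq_radialPrimitive_sub (k := S.ratio)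
      (fun _ => norm_ratio_le ha₁ hz₁) (continuousOn_ratio ha₁ hz₁)
      (fun _ => differentiableAt_ratio ha₁ hz₁) ht (fun s hs => hv s hs.1)
      (fun s hs => hv' s hs.1)
      ((continuousOn_branching S.ae_m_nonneg S.integrable_m).comp hvc fun s hs => hv s hs.1)
      (fun s _ h0 => by rw [h0, branching_zero])
    rw [hv0] at key
    rw [← key]
    refine intervalIntegral.integral_congr fun s hs => ?_
    rw [uIcc_of_le ht] at hs
    rcases eq_or_ne (v s) 0 with h0 | h0
    · simp only [h0, branching_zero, mul_zero]
      simp only [hv_def] at h0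
      rw [h0, immigration_zero]
    · exact (div_mul_cancel₀ _ (branching_ne_zero ha₁ (hv s hs.1) h0)).symm

lemma charFun_eq_of_isStationary {π : Measure (ℝ × ℝ)} (ha₁ : 0 < S.a₁)
    (hz₁ : ∫⁻ z in {z : ℝ × ℝ | 1 < z.1}, ENNReal.ofReal z.1 ∂S.n < ⊤) (hπ : IsStationary S.P π)
    {u : ℂ} (hu : u.re = 0) :
    ∫ y : ℝ × ℝ, Complex.exp (u * (y.1 : ℂ)) ∂π = Complex.exp (-radialPrimitive S.ratio u) := by
  have := hπ.1
  have hπ0 : ∀ᵐ y ∂π, 0 ≤ y.1 :=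
    measure_mono_null (fun y hy => show y.1 < 0 from not_le.1 hy) hπ.2.1
  obtain ⟨v, hv, hlim, hchar⟩ := exists_flow ha₁ hz₁ hu
  set L : ℂ → ℂ := fun w => ∫ y : ℝ × ℝ, Complex.exp (w * (y.1 : ℂ)) ∂π with hL
  have hstat : ∀ t, 0 ≤ t → L u = L (v t)
      * Complex.exp (radialPrimitive S.ratio (v t) - radialPrimitive S.ratio u) := by
    intro t ht
    have hint : Integrable (fun y : ℝ × ℝ => Complex.exp (u * (y.1 : ℂ))) (π.bind (S.P t)) := by
      rw [hπ.2.2 t ht]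
      refine (integrable_const (1 : ℝ)).mono' (by fun_prop) ?_
      filter_upwards [hπ0] with y hy using norm_exp_mul_ofReal_le_one hu.le hy
    have h := integral_bind_of_integrable (S.P_meas t ht) hint
    rw [hπ.2.2 t ht] at h
    simp only [hL]
    rw [h, ← integral_mul_const]
    refine integral_congr_ae ?_
    filter_upwards [hπ0] with x hx using hchar t ht x hx
  have hlim' : Tendsto v atTop (𝓝[{w | w.re ≤ 0}] 0) := by
    refine tendsto_nhdsWithin_iff.2 ⟨hlim, ?_⟩
    filter_upwards [eventually_ge_atTop 0] with t ht using hv t ht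
  have hLc : ContinuousOn L {w | w.re ≤ 0} := by
    have h := (diffContOnCl_laplace hπ0).continuousOn
    rwa [Complex.closure_setOfPred_re_lt] at h
  have hKc : ContinuousOn (radialPrimitive S.ratio) {w | w.re ≤ 0} :=
    continuousOn_radialPrimitive (fun _ => norm_ratio_le ha₁ hz₁) (continuousOn_ratio ha₁ hz₁)
  have h0 : (0 : ℂ) ∈ {w : ℂ | w.re ≤ 0} := by simp
  have h1 : Tendsto (fun t => L (v t)) atTop (𝓝 1) := by
    have h := (hLc 0 h0).tendsto.comp hlim'
    simpa [hL, Function.comp_def] using h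
  have h2 : Tendsto (fun t => radialPrimitive S.ratio (v t)) atTop (𝓝 0) := by
    have h := (hKc 0 h0).tendsto.comp hlim'
    rwa [radialPrimitive_zero] at h
  have h3 := h1.mul ((Complex.continuous_exp.tendsto _).comp
    (h2.sub_const (radialPrimitive S.ratio u)))
  rw [one_mul, zero_sub] at h3
  refine tendsto_nhds_unique (tendsto_const_nhds.congr' ?_) h3
  filter_upwards [eventually_ge_atTop 0] with t ht using hstat t ht

lemma ratio_ofReal (x : ℝ) :
    S.ratio x = ((Pfun S.a₂ S.n x / tphi0 S.a₁ S.α₁₁ S.α₁₂ S.m x : ℝ) : ℂ) := by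
  rw [ratio, immigration_ofReal, branching_ofReal, Complex.ofReal_div]

end AffineSemigroup

/-- Laplace transform of the first marginal of the stationary distribution. -/
theorem stationary_laplace_transform
    (S : AffineSemigroup) (π : Measure (ℝ × ℝ))
    (ha₁ : 0 < S.a₁) (hb₂ : 0 < S.b₂)
    (hz₁ : ∫⁻ z in {z : ℝ × ℝ | 1 < z.1}, ENNReal.ofReal z.1 ∂S.n < ⊤)
    (hπ : IsStationary S.P π)
    (huniq : ∀ π' : Measure (ℝ × ℝ), IsStationary S.P π' → π' = π) :
    ∀ u₁ : ℝ, u₁ ≤ 0 →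
      ∫ y : ℝ × ℝ, Real.exp (u₁ * y.1) ∂π
        = Real.exp (∫ z in u₁..(0:ℝ),
            Pfun S.a₂ S.n z / tphi0 S.a₁ S.α₁₁ S.α₁₂ S.m z) := by
  intro u₁ hu₁
  have := hπ.1
  have hπ0 : ∀ᵐ y ∂π, 0 ≤ y.1 :=
    measure_mono_null (fun y hy => show y.1 < 0 from not_le.1 hy) hπ.2.1
  have hB := fun u : ℂ => AffineSemigroup.norm_ratio_le (u := u) ha₁ hz₁
  have hc := AffineSemigroup.continuousOn_ratio ha₁ hz₁
  have hd := fun u : ℂ => AffineSemigroup.differentiableAt_ratio (u := u) ha₁ hz₁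
  have hK := radialPrimitive_ofReal (AffineSemigroup.ratio_ofReal (S := S))
  have h := eqOn_left_half_plane (C := 1)
    (G := fun u => Complex.exp (-radialPrimitive S.ratio u))
    (diffContOnCl_laplace hπ0) ⟨fun u hu => ?_, ?_⟩ (fun u => norm_laplace_le_one hπ0)
    ((norm_nonneg _).trans (hB 0 le_rfl)) (fun u hu => ?_) (fun x hx => ?_)
    (fun θ => AffineSemigroup.charFun_eq_of_isStationary ha₁ hz₁ hπ (by simp))
    (u := u₁) (by simpa using hu₁)
  · simp only [hK, neg_neg, ← Complex.ofReal_exp, ← Complex.ofReal_mul] at h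
    rw [integral_complex_ofReal] at h
    exact Complex.ofReal_injective h
  · exact (hasDerivAt_radialPrimitive hB hc hd hu).neg.cexp.differentiableAt.differentiableWithinAt
  · rw [Complex.closure_setOfPred_re_lt]
    exact (continuousOn_radialPrimitive hB hc).neg.cexp
  · rw [Complex.norm_exp]
    refine Real.exp_le_exp.2 ((Complex.re_le_norm _).trans ?_)
    rw [norm_neg]
    exact norm_radialPrimitive_le hB hu
  · rw [hK, neg_neg, Complex.norm_exp, Complex.ofReal_re, Real.exp_le_one_iff,
      intervalIntegral.integral_of_le hx]
    refine setIntegral_nonpos measurableSet_Ioc fun z hz => ?_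
    exact div_nonpos_of_nonpos_of_nonneg (Pfun_nonpos S.a₂_nonneg S.ae_n_nonneg hz.2)
      (tphi0_nonneg ha₁.le S.α₁₁_nonneg S.α₁₂_nonneg hz.2)

end AffinePaper
end
end

section
/- Convergence to zero of the Riccati flow on the negative half-line. Assume a₁ > 0 and let u₁ ≤ 0 be real. Define φ̃₀(z) = −a₁ z + (α₁₁+α₁₂) z² + ∫_G (e^{z z₁} − 1 − z z₁) m(dz') for real z ≤ 0, where z₁ denotes the first coordinate of z'. Then the initial value problem v'(t) = φ̃₀(v(t)), v(0) = u₁, has a unique solution v : [0,∞) → ℝ; it satisfies u₁ ≤ v(t) ≤ 0 for all t ≥ 0, v is nondecreasing, and v(t) → 0 as t → ∞. -/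
open MeasureTheory Filter Set Topology
open scoped ENNReal Classical

noncomputable section

namespace AffinePaper

/-- Two forward solutions of `x' = f x` with the same initial value coincide, if `f` is locally
Lipschitz on an open set containing one of them. -/
theorem ode_forward_unique {f : ℝ → ℝ} {s : Set ℝ} (hs : IsOpen s)
    (hf : LocallyLipschitzOn s f) {v w : ℝ → ℝ} {b : ℝ} (h0 : w 0 = v 0)
    (hv : ∀ t ∈ Icc 0 b, HasDerivWithinAt v (f (v t)) (Icc 0 b) t)
    (hw : ∀ t ∈ Icc 0 b, HasDerivWithinAt w (f (w t)) (Icc 0 b) t)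
    (hvs : ∀ t ∈ Icc 0 b, v t ∈ s) : EqOn w v (Icc 0 b) := by
  have hvc : ContinuousOn v (Icc 0 b) := fun t ht => (hv t ht).continuousWithinAt
  have hwc : ContinuousOn w (Icc 0 b) := fun t ht => (hw t ht).continuousWithinAt
  have key : Icc 0 b ⊆ {t | w t = v t} := by
    refine IsClosed.Icc_subset_of_forall_mem_nhdsWithin ?_ h0 ?_
    · have : {t | w t = v t} ∩ Icc 0 b = Icc 0 b ∩ (fun t => w t - v t) ⁻¹' {0} := by
        ext t; simp [sub_eq_zero, and_comm]
      rw [this]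
      exact (hwc.sub hvc).preimage_isClosed_of_isClosed isClosed_Icc isClosed_singleton
    · rintro x ⟨hx, hxI⟩
      have hxI' : x ∈ Icc 0 b := ⟨hxI.1, hxI.2.le⟩
      obtain ⟨K, t, ht, hK⟩ := hf (hvs x hxI')
      rw [hs.nhdsWithin_eq (hvs x hxI')] at ht
      have hmono : Icc x b ⊆ Icc 0 b := Icc_subset_Icc_left hxI.1
      have e1 : ∀ᶠ y in 𝓝[Icc x b] x, v y ∈ t :=
        ((hvc x hxI').mono hmono) ht
      have e2 : ∀ᶠ y in 𝓝[Icc x b] x, w y ∈ t := by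
        refine ((hwc x hxI').mono hmono) ?_
        rwa [show w x = v x from hx]
      have e3 : ∀ᶠ y in 𝓝[≥] x, v y ∈ t ∧ w y ∈ t ∧ y < b := by
        rw [nhdsWithin_Icc_eq_nhdsGE hxI.2] at e1 e2
        filter_upwards [e1, e2, mem_nhdsWithin_of_mem_nhds (Iio_mem_nhds hxI.2)] with y h1 h2 h3
        exact ⟨h1, h2, h3⟩
      obtain ⟨c, hc, hsub⟩ := (mem_nhdsGE_iff_exists_Icc_subset).1 e3
      have hcb : c < b := (hsub ⟨le_of_lt hc, le_rfl⟩).2.2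
      have hmono' : Icc x c ⊆ Icc 0 b := Icc_subset_Icc hxI.1 hcb.le
      have hder : ∀ {g : ℝ → ℝ}, (∀ t ∈ Icc 0 b, HasDerivWithinAt g (f (g t)) (Icc 0 b) t) →
          ∀ y ∈ Ico x c, HasDerivWithinAt g (f (g y)) (Ici y) y := by
        intro g hg y hy
        have hyI := hmono' ⟨hy.1, hy.2.le⟩
        exact (hg y hyI).mono_of_mem_nhdsWithin
          (mem_of_superset (Icc_mem_nhdsGE (hy.2.trans hcb)) (Icc_subset_Icc_left hyI.1))
      have heq : EqOn w v (Icc x c) :=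
        ODE_solution_unique_of_mem_Icc_right (v := fun _ => f) (s := fun _ => t) (K := K)
          (fun _ _ => hK) (hwc.mono hmono') (hder hw)
          (fun y hy => (hsub ⟨hy.1, hy.2.le⟩).2.1) (hvc.mono hmono') (hder hv)
          (fun y hy => (hsub ⟨hy.1, hy.2.le⟩).1) hx
      exact mem_of_superset (Icc_mem_nhdsGT hc) heq
  exact key

/-- A bounded Lipschitz autonomous ODE on the line has a forward solution on `[0, ∞)`. -/
theorem exists_forward_solution {f : ℝ → ℝ} {K : NNReal} (hf : LipschitzWith K f) {L : NNReal}
    (hL : ∀ x, ‖f x‖ ≤ L) (u : ℝ) :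
    ∃ v : ℝ → ℝ, v 0 = u ∧ ∀ t ≥ (0 : ℝ), HasDerivWithinAt v (f (v t)) (Ici 0) t := by
  have hex : ∀ n : ℕ, ∃ α : ℝ → ℝ, α 0 = u ∧
      ∀ t ∈ Icc (0 : ℝ) n, HasDerivWithinAt α (f (α t)) (Icc (0 : ℝ) n) t := by
    intro n
    have hPL : IsPicardLindelof (fun _ => f) (tmin := 0) (tmax := n)
        ⟨0, le_rfl, Nat.cast_nonneg n⟩ u (L * n) 0 L K :=
      .of_time_independent (fun x _ => hL x) hf.lipschitzOnWith (by simp)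
    exact hPL.exists_eq_forall_mem_Icc_hasDerivWithinAt₀
  choose α h0 hα using hex
  have hcons : ∀ {n k : ℕ}, n ≤ k → EqOn (α k) (α n) (Icc (0 : ℝ) n) := fun {n k} hnk =>
    ode_forward_unique isOpen_univ (locallyLipschitzOn_univ.2 hf.locallyLipschitz)
      ((h0 k).trans (h0 n).symm) (hα n)
      (fun t ht =>
        have hsub : Icc (0 : ℝ) n ⊆ Icc (0 : ℝ) k := Icc_subset_Icc_right (by exact_mod_cast hnk)
        (hα k t (hsub ht)).mono hsub)
      (fun _ _ => mem_univ _)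
  have hagree : ∀ (n : ℕ), EqOn (fun t => α (⌊t⌋₊ + 1) t) (α n) (Ico (0 : ℝ) n) := by
    intro n t ht
    have h1 : ⌊t⌋₊ + 1 ≤ n := (Nat.floor_lt ht.1).2 ht.2
    exact (hcons h1 ⟨ht.1, by push_cast; exact (Nat.lt_floor_add_one t).le⟩).symm
  refine ⟨fun t => α (⌊t⌋₊ + 1) t, by simp [h0], fun t ht => ?_⟩
  obtain ⟨n, hn⟩ := exists_nat_gt t
  have hnhds : Ico (0 : ℝ) n ∈ 𝓝[Ici 0] t :=
    Ici_inter_Iio (a := (0 : ℝ)) ▸ inter_mem_nhdsWithin (Ici (0 : ℝ)) (Iio_mem_nhds hn)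
  have hval := hagree n ⟨ht, hn⟩
  have hd := (hα n t ⟨ht, hn.le⟩).mono_of_mem_nhdsWithin (mem_of_superset hnhds Ico_subset_Icc_self)
  simp only at hval
  rw [← hval] at hd
  exact hd.congr_of_eventuallyEq ((hagree n).eventuallyEq_of_mem hnhds) hval

/-- The flow of a vector field on the line which vanishes at `0`, dominates `-a x` on the negative
half-line and is locally Lipschitz to the left of a positive number. -/
theorem flow_to_zero {f : ℝ → ℝ} {a δ u : ℝ} (ha : 0 < a) (hδ : 0 < δ) (hu : u ≤ 0)
    (hf : LocallyLipschitzOn (Iio δ) f) (hf0 : f 0 = 0) (hfa : ∀ z ≤ 0, -a * z ≤ f z) :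
    ∃ v : ℝ → ℝ,
      (v 0 = u ∧ ∀ t ≥ (0:ℝ), HasDerivWithinAt v (f (v t)) (Ici 0) t) ∧
      (∀ w : ℝ → ℝ,
        (w 0 = u ∧ ∀ t ≥ (0:ℝ), HasDerivWithinAt w (f (w t)) (Ici 0) t) →
        ∀ t ≥ (0:ℝ), w t = v t) ∧
      (∀ t ≥ (0:ℝ), u ≤ v t ∧ v t ≤ 0) ∧
      MonotoneOn v (Ici 0) ∧
      Tendsto v atTop (𝓝 0) := by
  have hsub : Icc u 0 ⊆ Iio δ := fun z hz => lt_of_le_of_lt hz.2 hδ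
  obtain ⟨K, hK⟩ := (hf.mono hsub).exists_lipschitzOnWith_of_compact isCompact_Icc
  obtain ⟨C, hC⟩ := isCompact_Icc.exists_bound_of_continuousOn (hf.mono hsub).continuousOn
  have hlip : LipschitzWith (K * 1) ((Icc u 0).domRestrict f ∘ projIcc u 0 hu) :=
    (lipschitzOnWith_iff_restrict.1 hK).comp (LipschitzWith.projIcc hu)
  set F : ℝ → ℝ := (Icc u 0).domRestrict f ∘ projIcc u 0 hu with hF
  have hFin : ∀ z ∈ Icc u 0, F z = f z := fun z hz => by
    simp [hF, projIcc_of_mem hu hz]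
  have hFpos : ∀ z ≥ 0, F z = 0 := fun z hz => by
    simp [hF, projIcc_of_right_le hu hz, hf0]
  have hFnn : ∀ z, 0 ≤ F z := fun z => by
    have h := (projIcc u 0 hu z).2
    have := hfa _ h.2
    simp only [hF, Function.comp_apply, domRestrict_apply]
    nlinarith [h.2]
  have hFb : ∀ z, ‖F z‖ ≤ C.toNNReal := fun z =>
    (hC _ (projIcc u 0 hu z).2).trans (Real.le_coe_toNNReal C)
  obtain ⟨v, hv0, hv⟩ := exists_forward_solution hlip hFb u
  have hvc : ContinuousOn v (Ici 0) := fun t ht => (hv t ht).continuousWithinAt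
  have hmono : MonotoneOn v (Ici 0) :=
    monotoneOn_of_hasDerivWithinAt_nonneg (convex_Ici 0) hvc
      (fun t ht => (hv t (interior_subset ht)).mono interior_subset) (fun t _ => hFnn (v t))
  have hlow : ∀ t ≥ 0, u ≤ v t := fun t ht => hv0 ▸ hmono self_mem_Ici ht ht
  have hup : ∀ t ≥ 0, v t ≤ 0 := by
    intro t ht
    have hε : ∀ ε > 0, v t ≤ ε * (1 + t) := by
      intro ε hε
      refine image_le_of_deriv_right_lt_deriv_boundary (f := v) (f' := fun t => F (v t)) (a := 0)
        (b := t) (B := fun t => ε * (1 + t)) (B' := fun _ => ε) (hvc.mono Icc_subset_Ici_self)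
        (fun x hx => (hv x hx.1).mono (Ici_subset_Ici.2 hx.1)) (by simp [hv0]; linarith)
        (fun x => by simpa using ((hasDerivAt_id x).const_add 1).const_mul ε) ?_ ⟨ht, le_rfl⟩
      intro x hx hxe
      have : 0 ≤ v x := by rw [hxe]; have := hx.1; positivity
      simpa [hFpos _ this] using hε
    by_contra! hpos
    have := hε (v t / (2 * (1 + t))) (by positivity)
    rw [div_mul_eq_mul_div, le_div_iff₀ (by positivity)] at this
    nlinarith
  have hvf : ∀ t ≥ 0, HasDerivWithinAt v (f (v t)) (Ici 0) t := fun t ht =>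
    hFin (v t) ⟨hlow t ht, hup t ht⟩ ▸ hv t ht
  refine ⟨v, ⟨hv0, hvf⟩, ?_, fun t ht => ⟨hlow t ht, hup t ht⟩, hmono, ?_⟩
  · rintro w ⟨hw0, hw⟩ t ht
    exact ode_forward_unique isOpen_Iio hf (hw0.trans hv0.symm)
      (fun s hs => (hvf s hs.1).mono Icc_subset_Ici_self)
      (fun s hs => (hw s hs.1).mono Icc_subset_Ici_self)
      (fun s hs => (hup s hs.1).trans_lt hδ) ⟨ht, le_rfl⟩
  · have hder : ∀ t ≥ 0, HasDerivWithinAt (fun t => Real.exp (a * t) * v t)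
        (Real.exp (a * t) * a * v t + Real.exp (a * t) * f (v t)) (Ici 0) t := fun t ht => by
      have h1 : HasDerivAt (fun t => Real.exp (a * t)) (Real.exp (a * t) * a) t := by
        simpa using ((hasDerivAt_id t).const_mul a).exp
      exact h1.hasDerivWithinAt.mul (hvf t ht)
    have hmono' : MonotoneOn (fun t => Real.exp (a * t) * v t) (Ici 0) :=
      monotoneOn_of_hasDerivWithinAt_nonneg (convex_Ici 0)
        (fun t ht => (hder t ht).continuousWithinAt)
        (fun t ht => (hder t (interior_subset ht)).mono interior_subset) (fun t ht => by
          have h := hfa _ (hup t (interior_subset ht))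
          have := mul_le_mul_of_nonneg_left h (Real.exp_pos (a * t)).le
          linarith)
    have hlim : Tendsto (fun t => Real.exp (-(a * t)) * u) atTop (𝓝 0) := by
      simpa using ((Real.tendsto_exp_neg_atTop_nhds_zero.comp
        (tendsto_id.const_mul_atTop ha)).mul_const u)
    refine tendsto_of_tendsto_of_tendsto_of_le_of_le' hlim tendsto_const_nhds ?_ ?_
    · filter_upwards [eventually_ge_atTop 0] with t ht
      have h : u ≤ Real.exp (a * t) * v t := by
        simpa [hv0] using hmono' self_mem_Ici ht ht
      calc Real.exp (-(a * t)) * u ≤ Real.exp (-(a * t)) * (Real.exp (a * t) * v t) := by gcongr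
        _ = v t := by rw [← mul_assoc, ← Real.exp_add]; simp
    · filter_upwards [eventually_ge_atTop 0] with t ht using hup t ht

/-- The compensated exponential is convex in its parameter. -/
theorem convexOn_exp_compensated (x : ℝ) :
    ConvexOn ℝ univ fun z : ℝ => Real.exp (z * x) - 1 - z * x := by
  have h := (convexOn_exp.comp_linearMap (LinearMap.mulRight ℝ x)).add
    ((LinearMap.mulRight ℝ (-x)).convexOn convex_univ) |>.add_const (-1)
  refine h.congr fun z _ => ?_
  simp
  ring

theorem exp_compensated_nonneg (z x : ℝ) : 0 ≤ Real.exp (z * x) - 1 - z * x := by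
  linarith [Real.add_one_le_exp (z * x)]

theorem exp_compensated_le {z x : ℝ} (hz : z ≤ 0) (hx : 0 ≤ x) :
    Real.exp (z * x) - 1 - z * x ≤ (-z + z ^ 2) * min x (x ^ 2) := by
  have hu : z * x ≤ 0 := mul_nonpos_of_nonpos_of_nonneg hz hx
  have h1 : Real.exp (z * x) ≤ 1 := Real.exp_le_one_iff.2 hu
  have h2 : Real.exp (z * x) - 1 - z * x ≤ (z * x) ^ 2 := by
    by_cases h : -1 ≤ z * x
    · exact (le_abs_self _).trans
        (Real.abs_exp_sub_one_sub_id_le (abs_le.2 ⟨h, hu.trans zero_le_one⟩))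
    · nlinarith
  rcases min_cases x (x ^ 2) with ⟨h, -⟩ | ⟨h, -⟩ <;> rw [h] <;>
    nlinarith [mul_nonneg (sq_nonneg z) hx, mul_nonneg (neg_nonneg.2 hz) (sq_nonneg x)]

/-- The integral of a family of functions convex in a parameter is convex. -/
theorem convexOn_integral {α : Type*} [MeasurableSpace α] {μ : Measure α} {g : ℝ → α → ℝ}
    {s : Set ℝ} (hs : Convex ℝ s) (hg : ∀ᵐ x ∂μ, ConvexOn ℝ s fun z => g z x)
    (hint : ∀ z ∈ s, Integrable (g z) μ) : ConvexOn ℝ s fun z => ∫ x, g z x ∂μ := by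
  refine ⟨hs, fun z hz y hy p q hp hq hpq => ?_⟩
  simp only [smul_eq_mul]
  rw [← integral_const_mul, ← integral_const_mul,
    ← integral_add ((hint z hz).const_mul p) ((hint y hy).const_mul q)]
  refine integral_mono_ae (hint _ (hs hz hy hp hq hpq))
    (((hint z hz).const_mul p).add ((hint y hy).const_mul q)) ?_
  filter_upwards [hg] with x hx
  simpa using hx.2 hz hy hp hq hpq

theorem integrable_exp_compensated {m : Measure (ℝ × ℝ)}
    (hm_supp : m {z : ℝ × ℝ | z.1 < 0 ∨ z = 0} = 0)
    (hm_int : ∫⁻ z : ℝ × ℝ, ENNReal.ofReal (min z.1 (z.1 ^ 2) + z.2 ^ 2) ∂m < ⊤)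
    {z : ℝ} (hz : z ≤ 0) :
    Integrable (fun w : ℝ × ℝ => Real.exp (z * w.1) - 1 - z * w.1) m := by
  have hpos : ∀ᵐ w ∂m, 0 ≤ w.1 := by
    refine measure_mono_null (fun w hw => ?_) hm_supp
    exact Or.inl (not_le.1 hw)
  have hdom : Integrable (fun w : ℝ × ℝ => min w.1 (w.1 ^ 2) + w.2 ^ 2) m := by
    refine (lintegral_ofReal_ne_top_iff_integrable ?_ ?_).1 hm_int.ne
    · exact Measurable.aestronglyMeasurable (by fun_prop)
    · filter_upwards [hpos] with w hw
      have := le_min hw (sq_nonneg w.1)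
      simp only [Pi.zero_apply]
      positivity
  refine (hdom.const_mul (-z + z ^ 2)).mono' (Measurable.aestronglyMeasurable (by fun_prop)) ?_
  filter_upwards [hpos] with w hw
  rw [Real.norm_of_nonneg (exp_compensated_nonneg z w.1)]
  refine (exp_compensated_le hz hw).trans (mul_le_mul_of_nonneg_left ?_ ?_)
  · linarith [sq_nonneg w.2]
  · nlinarith [sq_nonneg z]

/-- The integral part of the branching mechanism, with the Bochner integral set to zero where it
diverges, is convex to the left of some positive number. -/
theorem exists_convexOn_integral_exp_compensated {m : Measure (ℝ × ℝ)}
    (hm_supp : m {z : ℝ × ℝ | z.1 < 0 ∨ z = 0} = 0)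
    (hm_int : ∫⁻ z : ℝ × ℝ, ENNReal.ofReal (min z.1 (z.1 ^ 2) + z.2 ^ 2) ∂m < ⊤) :
    ∃ δ > 0, ConvexOn ℝ (Iio δ)
      fun z : ℝ => ∫ w : ℝ × ℝ, (Real.exp (z * w.1) - 1 - z * w.1) ∂m := by
  have hpos : ∀ᵐ w ∂m, 0 ≤ w.1 := by
    refine measure_mono_null (fun w hw => ?_) hm_supp
    exact Or.inl (not_le.1 hw)
  have hneg := fun {z : ℝ} => integrable_exp_compensated hm_supp hm_int (z := z)
  by_cases h : ∃ δ > 0, Integrable (fun w : ℝ × ℝ => Real.exp (δ * w.1) - 1 - δ * w.1) m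
  · obtain ⟨δ, hδ, hi⟩ := h
    refine ⟨δ, hδ, convexOn_integral (convex_Iio δ) (ae_of_all _ fun w =>
      (convexOn_exp_compensated w.1).subset (subset_univ _) (convex_Iio δ)) fun z hz => ?_⟩
    rcases le_total z 0 with hz0 | hz0
    · exact hneg hz0
    · refine hi.mono' (Measurable.aestronglyMeasurable (by fun_prop)) (ae_of_all _ fun w => ?_)
      rw [Real.norm_of_nonneg (exp_compensated_nonneg z w.1)]
      have hzδ : z / δ ≤ 1 := (div_le_one hδ).2 (le_of_lt hz)
      have hc := (convexOn_exp_compensated w.1).2 (mem_univ δ) (mem_univ 0)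
        (div_nonneg hz0 hδ.le) (sub_nonneg.2 hzδ) (by ring)
      simp only [smul_eq_mul, mul_zero, add_zero, zero_mul, Real.exp_zero, sub_self,
        div_mul_cancel₀ z hδ.ne'] at hc
      exact hc.trans (mul_le_of_le_one_left (exp_compensated_nonneg δ w.1) hzδ)
  · push Not at h
    refine ⟨1, one_pos, ?_⟩
    have hmin : (fun z : ℝ => ∫ w : ℝ × ℝ, (Real.exp (z * w.1) - 1 - z * w.1) ∂m)
        = fun z => ∫ w : ℝ × ℝ, (Real.exp (min z 0 * w.1) - 1 - min z 0 * w.1) ∂m := by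
      funext z
      rcases le_or_gt z 0 with hz | hz
      · rw [min_eq_left hz]
      · rw [integral_undef (h z hz), min_eq_right hz.le]
        simp
    rw [hmin]
    refine convexOn_integral (convex_Iio 1) ?_ fun z _ => hneg (min_le_right z 0)
    filter_upwards [hpos] with w hw
    have hc := (convexOn_exp_compensated w.1).subset (subset_univ (Iic 0)) (convex_Iic 0)
    refine ⟨convex_Iio 1, fun z _ y _ p q hp hq hpq => ?_⟩
    refine le_trans ?_ (hc.2 (min_le_right z 0) (min_le_right y 0) hp hq hpq)
    have hle : p • min z 0 + q • min y 0 ≤ min (p • z + q • y) 0 := by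
      simp only [smul_eq_mul]
      refine le_min ?_ ?_
      · gcongr <;> exact min_le_left _ _
      · nlinarith [min_le_right z 0, min_le_right y 0]
    have hA : min (p • z + q • y) 0 ≤ 0 := min_le_right _ _
    set A := min (p • z + q • y) 0
    set B := p • min z 0 + q • min y 0
    have h1 : Real.exp (A * w.1) - Real.exp (B * w.1) ≤ (A - B) * w.1 := by
      have hAw : A * w.1 ≤ 0 := mul_nonpos_of_nonpos_of_nonneg hA hw
      have e1 : Real.exp (A * w.1) ≤ 1 := Real.exp_le_one_iff.2 hAw
      have e2 : Real.exp (B * w.1) = Real.exp (A * w.1) * Real.exp ((B - A) * w.1) := by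
        rw [← Real.exp_add]; ring_nf
      have e3 := Real.add_one_le_exp ((B - A) * w.1)
      rw [e2]
      have e4 := mul_le_mul_of_nonneg_left e3 (Real.exp_pos (A * w.1)).le
      have e5 : 0 ≤ (A - B) * w.1 := mul_nonneg (sub_nonneg.2 hle) hw
      nlinarith
    linarith

/-- Convergence to zero of the Riccati flow on the negative half-line. -/
theorem riccati_flow_to_zero
    (a₁ α₁₁ α₁₂ : ℝ) (m : Measure (ℝ × ℝ))
    (hα₁₁ : 0 ≤ α₁₁) (hα₁₂ : 0 ≤ α₁₂)
    (hm_supp : m {z : ℝ × ℝ | z.1 < 0 ∨ z = 0} = 0)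
    (hm_int : ∫⁻ z : ℝ × ℝ, ENNReal.ofReal (min z.1 (z.1 ^ 2) + z.2 ^ 2) ∂m < ⊤)
    (ha₁ : 0 < a₁) (u₁ : ℝ) (hu₁ : u₁ ≤ 0) :
    ∃ v : ℝ → ℝ,
      (v 0 = u₁ ∧ ∀ t ≥ (0:ℝ),
        HasDerivWithinAt v (tphi0 a₁ α₁₁ α₁₂ m (v t)) (Set.Ici 0) t) ∧
      (∀ w : ℝ → ℝ,
        (w 0 = u₁ ∧ ∀ t ≥ (0:ℝ),
          HasDerivWithinAt w (tphi0 a₁ α₁₁ α₁₂ m (w t)) (Set.Ici 0) t) →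
        ∀ t ≥ (0:ℝ), w t = v t) ∧
      (∀ t ≥ (0:ℝ), u₁ ≤ v t ∧ v t ≤ 0) ∧
      MonotoneOn v (Set.Ici 0) ∧
      Tendsto v atTop (𝓝 0) := by
  obtain ⟨δ, hδ, hconv⟩ := exists_convexOn_integral_exp_compensated hm_supp hm_int
  have hlin : ConvexOn ℝ (Iio δ) fun z : ℝ => -a₁ * z :=
    (LinearMap.mulLeft ℝ (-a₁)).convexOn (convex_Iio δ)
  have hsq : ConvexOn ℝ (Iio δ) fun z : ℝ => (α₁₁ + α₁₂) * z ^ 2 :=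
    (even_two.convexOn_pow.smul (add_nonneg hα₁₁ hα₁₂)).subset (subset_univ _) (convex_Iio δ)
  have hf : ConvexOn ℝ (Iio δ) (tphi0 a₁ α₁₁ α₁₂ m) := (hlin.add hsq).add hconv
  refine flow_to_zero ha₁ hδ hu₁ (hf.locallyLipschitzOn isOpen_Iio) (by simp [tphi0]) ?_
  intro z _
  have h1 : 0 ≤ ∫ w : ℝ × ℝ, (Real.exp (z * w.1) - 1 - z * w.1) ∂m :=
    integral_nonneg fun w => exp_compensated_nonneg z w.1
  have h2 : 0 ≤ (α₁₁ + α₁₂) * z ^ 2 := by positivity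
  unfold tphi0
  linarith

end AffinePaper
end
end
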